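/- Let u be a solution of the IVP that changes sign and has exactly k ≥ 1 zeros z₁ < ⋯ < z_k, and let v be the variation associated with u. Then v has exactly k zeros τ₁ < ⋯ < τ_k in the interval [0, z_k]; moreover τ₁ ∈ (0, z₁), τ_i ∈ (z_{i−1}, z_i) for 2 ≤ i ≤ k, and u'(τ_i) · v'(τ_i) > 0 for each i ∈ {1,…,k}. -/

import Mathlib

open Real Filter Set

/-- The nonlinearity `f(s) = -s + |s|^(p-1) s`. -/
noncomputable def f (p s : ℝ) : ℝ := -s + |s| ^ (p - 1) * s

/-- The derivative of the nonlinearity, `f'(s) = -1 + p |s|^(p-1)`. -/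
noncomputable def fder (p s : ℝ) : ℝ := -1 + p * |s| ^ (p - 1)

/-- The primitive `F(s) = -s^2/2 + |s|^(p+1)/(p+1)`. -/
noncomputable def F (p s : ℝ) : ℝ := -s ^ 2 / 2 + |s| ^ (p + 1) / (p + 1)

/-- `u : [0,∞) → ℝ` (modeled on `Set.Ici 0`) is a C² solution of the IVP
`u'' + ((n-1)/r) u' + f(u) = 0`, `u(0) = α`, `u'(0) = 0`; the data `u'`, `u''`
are its first and second derivatives on `[0,∞)`. -/
structure IsSolution (n : ℕ) (p α : ℝ) (u u' u'' : ℝ → ℝ) : Prop where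
  init : u 0 = α
  initDeriv : u' 0 = 0
  hasDeriv1 : ∀ r ∈ Set.Ici (0:ℝ), HasDerivWithinAt u (u' r) (Set.Ici 0) r
  hasDeriv2 : ∀ r ∈ Set.Ici (0:ℝ), HasDerivWithinAt u' (u'' r) (Set.Ici 0) r
  cont2 : ContinuousOn u'' (Set.Ici 0)
  ode : ∀ r : ℝ, 0 < r → u'' r + ((n : ℝ) - 1) / r * u' r + f p (u r) = 0

/-- The variation `v` associated with a solution `u`: the C² solution of the linearized
equation `v'' + ((n-1)/r) v' + f'(u) v = 0`, `v(0) = 1`, `v'(0) = 0`. -/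
structure IsVariation (n : ℕ) (p : ℝ) (u v v' v'' : ℝ → ℝ) : Prop where
  init : v 0 = 1
  initDeriv : v' 0 = 0
  hasDeriv1 : ∀ r ∈ Set.Ici (0:ℝ), HasDerivWithinAt v (v' r) (Set.Ici 0) r
  hasDeriv2 : ∀ r ∈ Set.Ici (0:ℝ), HasDerivWithinAt v' (v'' r) (Set.Ici 0) r
  cont2 : ContinuousOn v'' (Set.Ici 0)
  ode : ∀ r : ℝ, 0 < r → v'' r + ((n : ℝ) - 1) / r * v' r + fder p (u r) * v r = 0

/-- `u` is decaying: `u(r) → 0` and `u'(r) → 0` as `r → ∞`. -/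
def Decaying (u u' : ℝ → ℝ) : Prop :=
  Filter.Tendsto u Filter.atTop (nhds 0) ∧ Filter.Tendsto u' Filter.atTop (nhds 0)

/-- `u` changes sign on `(0,∞)`. -/
def ChangesSign (u : ℝ → ℝ) : Prop :=
  (∃ r : ℝ, 0 < r ∧ u r < 0) ∧ (∃ r : ℝ, 0 < r ∧ 0 < u r)

/-- `z 0 < z 1 < ⋯ < z (k-1)` are exactly the zeros of `u` in `(0,∞)`. -/
def ExactZeros (u : ℝ → ℝ) (k : ℕ) (z : Fin k → ℝ) : Prop :=
  StrictMono z ∧ (∀ i, 0 < z i ∧ u (z i) = 0) ∧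
    ∀ r : ℝ, 0 < r → u r = 0 → ∃ i, r = z i

/-- `u` solves the radial equation and `v` its linearization on `(0,∞)`, with data continuous
up to the origin. -/
structure RadialPair (n : ℕ) (p : ℝ) (u u' v v' : ℝ → ℝ) : Prop where
  cont_u : ContinuousOn u (Ici 0)
  cont_u' : ContinuousOn u' (Ici 0)
  cont_v : ContinuousOn v (Ici 0)
  cont_v' : ContinuousOn v' (Ici 0)
  deriv_u : ∀ r, 0 < r → HasDerivAt u (u' r) r
  deriv_u' : ∀ r, 0 < r → HasDerivAt u' (-(((n : ℝ) - 1) / r * u' r) - f p (u r)) r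
  deriv_v : ∀ r, 0 < r → HasDerivAt v (v' r) r
  deriv_v' : ∀ r, 0 < r → HasDerivAt v' (-(((n : ℝ) - 1) / r * v' r) - fder p (u r) * v r) r

theorem f_neg (p s : ℝ) : f p (-s) = -f p s := by simp [f]; ring

theorem fder_neg (p s : ℝ) : fder p (-s) = fder p s := by simp [fder]

theorem F_neg (p s : ℝ) : F p (-s) = F p s := by simp [F]

theorem abs_rpow_add_one {p : ℝ} (hp : 1 < p) (s : ℝ) :
    |s| ^ (p + 1) = s ^ 2 * |s| ^ (p - 1) := by
  have h : p + 1 = 2 + (p - 1) := by ring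
  rw [h, Real.rpow_add_of_nonneg (abs_nonneg s) (by norm_num) (by linarith)]
  simp

theorem F_eq {p : ℝ} (hp : 1 < p) (s : ℝ) :
    F p s = s ^ 2 * (-1 / 2 + |s| ^ (p - 1) / (p + 1)) := by
  rw [F, abs_rpow_add_one hp]; ring

theorem f_eq (p s : ℝ) : f p s = s * (|s| ^ (p - 1) - 1) := by rw [f]; ring

theorem hasDerivAt_F {p : ℝ} (hp : 1 < p) (s : ℝ) : HasDerivAt (F p) (f p s) s := by
  have h1 := (hasDerivAt_abs_rpow s (by linarith : (1 : ℝ) < p + 1)).div_const (p + 1)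
  have h2 := ((hasDerivAt_id s).pow 2).neg.div_const 2
  have h3 := h2.add h1
  have hp' : p + 1 ≠ 0 := by linarith
  refine (h3.congr_deriv ?_).congr_of_eventuallyEq (Eventually.of_forall fun x => ?_)
  · rw [f, show p + 1 - 2 = p - 1 by ring]
    field_simp
    simp
    ring
  · simp [F]

theorem hasDerivAt_f {p s : ℝ} (hs : 0 < s) : HasDerivAt (f p) (fder p s) s := by
  have h1 : HasDerivAt (fun x : ℝ => -x + x ^ p) (-1 + p * s ^ (p - 1)) s :=
    (hasDerivAt_id s).neg.add (Real.hasDerivAt_rpow_const (Or.inl hs.ne'))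
  rw [fder, abs_of_pos hs]
  refine h1.congr_of_eventuallyEq ?_
  filter_upwards [lt_mem_nhds hs] with x hx
  rw [f, abs_of_pos hx, Real.rpow_sub_one hx.ne']
  field_simp

theorem le_of_hasDerivAt_nonneg {g g' : ℝ → ℝ} {a b : ℝ} (hab : a ≤ b)
    (hc : ContinuousOn g (Icc a b)) (hd : ∀ x ∈ Ioo a b, HasDerivAt g (g' x) x)
    (h0 : ∀ x ∈ Ioo a b, 0 ≤ g' x) : g a ≤ g b := by
  refine monotoneOn_of_hasDerivWithinAt_nonneg (f' := g') (convex_Icc a b) hc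
    (fun x hx => ?_) (fun x hx => ?_) (left_mem_Icc.2 hab) (right_mem_Icc.2 hab) hab
  · rw [interior_Icc] at hx ⊢; exact (hd x hx).hasDerivWithinAt
  · rw [interior_Icc] at hx; exact h0 x hx

theorem lt_of_hasDerivAt_pos {g g' : ℝ → ℝ} {a b : ℝ} (hab : a < b)
    (hc : ContinuousOn g (Icc a b)) (hd : ∀ x ∈ Ioo a b, HasDerivAt g (g' x) x)
    (h0 : ∀ x ∈ Ioo a b, 0 < g' x) : g a < g b := by
  refine strictMonoOn_of_hasDerivWithinAt_pos (f' := g') (convex_Icc a b) hc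
    (fun x hx => ?_) (fun x hx => ?_) (left_mem_Icc.2 hab.le) (right_mem_Icc.2 hab.le) hab
  · rw [interior_Icc] at hx ⊢; exact (hd x hx).hasDerivWithinAt
  · rw [interior_Icc] at hx; exact h0 x hx

theorem ge_of_hasDerivAt_nonpos {g g' : ℝ → ℝ} {a b : ℝ} (hab : a ≤ b)
    (hc : ContinuousOn g (Icc a b)) (hd : ∀ x ∈ Ioo a b, HasDerivAt g (g' x) x)
    (h0 : ∀ x ∈ Ioo a b, g' x ≤ 0) : g b ≤ g a := by
  have := le_of_hasDerivAt_nonneg hab hc.neg (fun x hx => (hd x hx).neg)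
    (fun x hx => by linarith [h0 x hx])
  simpa using this

theorem gt_of_hasDerivAt_neg {g g' : ℝ → ℝ} {a b : ℝ} (hab : a < b)
    (hc : ContinuousOn g (Icc a b)) (hd : ∀ x ∈ Ioo a b, HasDerivAt g (g' x) x)
    (h0 : ∀ x ∈ Ioo a b, g' x < 0) : g b < g a := by
  have := lt_of_hasDerivAt_pos hab hc.neg (fun x hx => (hd x hx).neg)
    (fun x hx => by linarith [h0 x hx])
  simpa using this

/-- A continuous function that is positive at every point up to which it is positive
stays positive. -/
theorem pos_of_forall_pos_before {g : ℝ → ℝ} {a b : ℝ} (hc : ContinuousOn g (Icc a b))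
    (step : ∀ r ∈ Icc a b, (∀ x ∈ Ico a r, 0 < g x) → 0 < g r) : ∀ r ∈ Icc a b, 0 < g r := by
  by_contra! hcon
  obtain ⟨r0, hr0, hg0⟩ := hcon
  have hcl : IsCompact (Icc a b ∩ g ⁻¹' Iic 0) :=
    isCompact_Icc.of_isClosed_subset (hc.preimage_isClosed_of_isClosed isClosed_Icc isClosed_Iic)
      inter_subset_left
  obtain ⟨m, hm, hmin⟩ := hcl.exists_isLeast ⟨r0, hr0, hg0⟩
  have := step m hm.1 fun x hx => by
    by_contra! hle
    exact absurd (hmin ⟨⟨hx.1, hx.2.le.trans hm.1.2⟩, hle⟩) (not_le.2 hx.2)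
  exact absurd hm.2 (not_le.2 this)

theorem hasDerivAt_weight {n : ℕ} (hn : 3 ≤ n) {r : ℝ} (hr : 0 < r) :
    HasDerivAt (fun x : ℝ => x ^ (n - 1)) (((n : ℝ) - 1) / r * r ^ (n - 1)) r := by
  refine (hasDerivAt_pow (n - 1) r).congr_deriv ?_
  obtain ⟨m, rfl⟩ : ∃ m, n = m + 2 := ⟨n - 2, by omega⟩
  simp
  field_simp
  ring

/-- The energy. -/
noncomputable def energy (p : ℝ) (u u' : ℝ → ℝ) (r : ℝ) : ℝ := u' r ^ 2 / 2 + F p (u r)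

/-- The Pohozaev functional. -/
noncomputable def pohozaev (n : ℕ) (p : ℝ) (u u' : ℝ → ℝ) (r : ℝ) : ℝ :=
  r ^ (n - 1) * (r * energy p u u' r + ((n : ℝ) - 2) / 2 * (u r * u' r))

/-- The weighted Wronskian of `v` and `r u' + β u`. -/
noncomputable def scalingWronskian (n : ℕ) (p β : ℝ) (u u' v v' : ℝ → ℝ) (r : ℝ) : ℝ :=
  r ^ (n - 1) * (((2 - (n : ℝ) + β) * u' r - r * f p (u r)) * v r
    - (r * u' r + β * u r) * v' r)

/-- The weighted Wronskian of `v` and `u`. -/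
noncomputable def wronskian (n : ℕ) (u u' v v' : ℝ → ℝ) (r : ℝ) : ℝ :=
  r ^ (n - 1) * (u' r * v r - u r * v' r)

/-- The Wronskian of `u'` and `v`, with `u''` eliminated through the equation. -/
noncomputable def translationWronskian (n : ℕ) (p : ℝ) (u u' v v' : ℝ → ℝ) (r : ℝ) : ℝ :=
  u' r * v' r + v r * (((n : ℝ) - 1) / r * u' r + f p (u r))

/-- A primitive, as a function of `u`, of the source term of `scalingWronskian`. -/
noncomputable def sourcePotential (p β s : ℝ) : ℝ :=
  s ^ 2 * (1 - (2 - β * (p - 1)) / (p + 1) * |s| ^ (p - 1))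

/-- The source potential corrected form of `scalingWronskian`. -/
noncomputable def modifiedWronskian (n : ℕ) (p β : ℝ) (u u' v v' : ℝ → ℝ) (r : ℝ) : ℝ :=
  r ^ (n - 1) * (v r / u' r) * sourcePotential p β (u r) - scalingWronskian n p β u u' v v' r

namespace RadialPair

variable {n : ℕ} {p : ℝ} {u u' v v' : ℝ → ℝ}

theorem neg (h : RadialPair n p u u' v v') :
    RadialPair n p (fun r => -u r) (fun r => -u' r) (fun r => -v r) (fun r => -v' r) where
  cont_u := h.cont_u.neg
  cont_u' := h.cont_u'.neg
  cont_v := h.cont_v.neg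
  cont_v' := h.cont_v'.neg
  deriv_u r hr := (h.deriv_u r hr).neg
  deriv_u' r hr := ((h.deriv_u' r hr).neg).congr_deriv (by rw [f_neg]; ring)
  deriv_v r hr := (h.deriv_v r hr).neg
  deriv_v' r hr := ((h.deriv_v' r hr).neg).congr_deriv (by rw [fder_neg]; ring)

theorem hasDerivAt_energy (h : RadialPair n p u u' v v') (hp : 1 < p) {r : ℝ} (hr : 0 < r) :
    HasDerivAt (energy p u u') (-(((n : ℝ) - 1) / r * u' r ^ 2)) r := by
  have h1 := (((h.deriv_u' r hr).pow 2).div_const 2).add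
    ((hasDerivAt_F hp (u r)).comp r (h.deriv_u r hr))
  refine h1.congr_deriv ?_
  simp
  ring

theorem hasDerivAt_pohozaev (h : RadialPair n p u u' v v') (hn : 3 ≤ n) (hp : 1 < p) {r : ℝ}
    (hr : 0 < r) :
    HasDerivAt (pohozaev n p u u') (r ^ (n - 1) * (u r ^ 2 *
      (-1 + ((n : ℝ) / (p + 1) - ((n : ℝ) - 2) / 2) * |u r| ^ (p - 1)))) r := by
  have h1 := (hasDerivAt_weight hn hr).mul (((hasDerivAt_id r).mul
    (h.hasDerivAt_energy hp hr)).add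
      (((h.deriv_u r hr).mul (h.deriv_u' r hr)).const_mul (((n : ℝ) - 2) / 2)))
  refine h1.congr_deriv ?_
  have hp' : p + 1 ≠ 0 := by linarith
  simp only [energy, F_eq hp, f_eq, id, Pi.add_apply, Pi.mul_apply]
  field_simp
  ring

theorem hasDerivAt_scalingWronskian (h : RadialPair n p u u' v v') (hn : 3 ≤ n) (β : ℝ)
    {r : ℝ} (hr : 0 < r) (hu : 0 < u r) :
    HasDerivAt (scalingWronskian n p β u u' v v') (r ^ (n - 1) * (v r *
      (2 * u r - (2 - β * (p - 1)) * |u r| ^ (p - 1) * u r))) r := by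
  have hf : HasDerivAt (fun x => f p (u x)) (fder p (u r) * u' r) r :=
    (hasDerivAt_f hu).comp r (h.deriv_u r hr)
  have h1 := (hasDerivAt_weight hn hr).mul
    ((((h.deriv_u' r hr).const_mul (2 - (n : ℝ) + β)).sub
      ((hasDerivAt_id r).mul hf)).mul (h.deriv_v r hr) |>.sub
    ((((hasDerivAt_id r).mul (h.deriv_u' r hr)).add
      ((h.deriv_u r hr).const_mul β)).mul (h.deriv_v' r hr)))
  refine h1.congr_deriv ?_
  simp only [f_eq, fder, id, Pi.add_apply, Pi.mul_apply, Pi.sub_apply]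
  field_simp
  ring

theorem hasDerivAt_wronskian (h : RadialPair n p u u' v v') (hn : 3 ≤ n)
    {r : ℝ} (hr : 0 < r) :
    HasDerivAt (wronskian n u u' v v') (r ^ (n - 1) * ((p - 1) * |u r| ^ (p - 1) *
      (u r * v r))) r := by
  have h1 := (hasDerivAt_weight hn hr).mul
    (((h.deriv_u' r hr).mul (h.deriv_v r hr)).sub ((h.deriv_u r hr).mul (h.deriv_v' r hr)))
  refine h1.congr_deriv ?_
  simp only [f_eq, fder, Pi.mul_apply, Pi.sub_apply]
  field_simp
  ring

theorem hasDerivAt_div (h : RadialPair n p u u' v v')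
    {r : ℝ} (hr : 0 < r) (hu' : u' r ≠ 0) :
    HasDerivAt (fun x => v x / u' x) (translationWronskian n p u u' v v' r / u' r ^ 2) r := by
  refine ((h.deriv_v r hr).div (h.deriv_u' r hr) hu').congr_deriv ?_
  rw [translationWronskian]
  field_simp
  ring

theorem hasDerivAt_sourcePotential (h : RadialPair n p u u' v v') (hp : 1 < p) (β : ℝ) {r : ℝ}
    (hr : 0 < r) :
    HasDerivAt (fun x => sourcePotential p β (u x))
      (u' r * (2 * u r - (2 - β * (p - 1)) * |u r| ^ (p - 1) * u r)) r := by
  have hp' : p + 1 ≠ 0 := by linarith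
  have h1 : HasDerivAt (sourcePotential p β)
      (2 * u r - (2 - β * (p - 1)) * |u r| ^ (p - 1) * u r) (u r) := by
    have h2 : HasDerivAt (fun s : ℝ => s ^ 2 - (2 - β * (p - 1)) / (p + 1) * |s| ^ (p + 1))
        (2 * u r - (2 - β * (p - 1)) / (p + 1) * ((p + 1) * |u r| ^ (p + 1 - 2) * u r))
        (u r) := by
      have h3 := (hasDerivAt_pow 2 (u r)).sub
        ((hasDerivAt_abs_rpow (u r) (by linarith : (1 : ℝ) < p + 1)).const_mul
          ((2 - β * (p - 1)) / (p + 1)))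
      exact h3.congr_deriv (by norm_num)
    refine (h2.congr_deriv ?_).congr_of_eventuallyEq (Eventually.of_forall fun x => ?_)
    · rw [show p + 1 - 2 = p - 1 by ring]
      field_simp
    · simp only [sourcePotential, abs_rpow_add_one hp]
      ring
  exact (h1.comp r (h.deriv_u r hr)).congr_deriv (by ring)

theorem hasDerivAt_modifiedWronskian (h : RadialPair n p u u' v v') (hn : 3 ≤ n) (hp : 1 < p)
    (β : ℝ) {r : ℝ} (hr : 0 < r) (hu : 0 < u r) (hu' : u' r ≠ 0) :
    HasDerivAt (modifiedWronskian n p β u u' v v') (r ^ (n - 1) *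
      (translationWronskian n p u u' v v' r / u' r ^ 2 + ((n : ℝ) - 1) / r * (v r / u' r)) *
        sourcePotential p β (u r)) r := by
  have h1 := (((hasDerivAt_weight hn hr).mul (h.hasDerivAt_div hr hu')).mul
    (h.hasDerivAt_sourcePotential hp β hr)).sub (h.hasDerivAt_scalingWronskian hn β hr hu)
  refine h1.congr_deriv ?_
  simp only [Pi.mul_apply]
  field_simp
  ring

theorem continuousOn_f (h : RadialPair n p u u' v v') (hp : 1 < p) :
    ContinuousOn (fun r => f p (u r)) (Ici 0) := by
  have : Continuous (f p) := by
    unfold f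
    have := Real.continuous_rpow_const (by linarith : (0 : ℝ) ≤ p - 1)
    fun_prop
  exact this.comp_continuousOn h.cont_u

theorem continuousOn_scalingWronskian (h : RadialPair n p u u' v v') (hp : 1 < p) (β : ℝ) :
    ContinuousOn (scalingWronskian n p β u u' v v') (Ici 0) := by
  have h0 := h.continuousOn_f hp
  have h1 := h.cont_u
  have h2 := h.cont_u'
  have h3 := h.cont_v
  have h4 := h.cont_v'
  unfold scalingWronskian
  fun_prop

theorem continuousOn_wronskian (h : RadialPair n p u u' v v') :
    ContinuousOn (wronskian n u u' v v') (Ici 0) := by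
  have h1 := h.cont_u
  have h2 := h.cont_u'
  have h3 := h.cont_v
  have h4 := h.cont_v'
  unfold wronskian
  fun_prop

theorem continuousOn_energy (h : RadialPair n p u u' v v') (hp : 1 < p) :
    ContinuousOn (energy p u u') (Ici 0) := by
  have hF : Continuous (F p) := continuous_iff_continuousAt.2 fun s =>
    (hasDerivAt_F hp s).continuousAt
  have h2 := h.cont_u'
  have h3 := hF.comp_continuousOn h.cont_u
  exact ((h2.pow 2).div_const 2).add h3

theorem continuousOn_pohozaev (h : RadialPair n p u u' v v') (hp : 1 < p) :
    ContinuousOn (pohozaev n p u u') (Ici 0) := by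
  have h0 := h.continuousOn_energy hp
  have h1 := h.cont_u
  have h2 := h.cont_u'
  unfold pohozaev
  fun_prop

theorem continuousOn_translationWronskian (h : RadialPair n p u u' v v') (hp : 1 < p) :
    ContinuousOn (translationWronskian n p u u' v v') (Ioi 0) := by
  have h0 := (h.continuousOn_f hp).mono Ioi_subset_Ici_self
  have h1 := h.cont_u.mono Ioi_subset_Ici_self
  have h2 := h.cont_u'.mono Ioi_subset_Ici_self
  have h3 := h.cont_v.mono Ioi_subset_Ici_self
  have h4 := h.cont_v'.mono Ioi_subset_Ici_self
  have h5 : ContinuousOn (fun r : ℝ => ((n : ℝ) - 1) / r) (Ioi 0) :=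
    continuousOn_const.div continuousOn_id fun x hx => (ne_of_gt hx)
  unfold translationWronskian
  fun_prop

theorem continuousOn_modifiedWronskian (h : RadialPair n p u u' v v') (hp : 1 < p) (β : ℝ)
    {s : Set ℝ} (hs : s ⊆ Ici 0) (hu' : ∀ r ∈ s, u' r ≠ 0) :
    ContinuousOn (modifiedWronskian n p β u u' v v') s := by
  have h0 := (h.continuousOn_scalingWronskian hp β).mono hs
  have h1 := h.cont_u.mono hs
  have h2 := (h.cont_v.mono hs).div (h.cont_u'.mono hs) hu'
  have h3 : Continuous (sourcePotential p β) := by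
    unfold sourcePotential
    have := Real.continuous_rpow_const (by linarith : (0 : ℝ) ≤ p - 1)
    fun_prop
  have h4 := h3.comp_continuousOn h1
  exact (((continuous_pow (n - 1)).continuousOn.mul h2).mul h4).sub h0

/-- Sign identity linking `modifiedWronskian`, the energy and the monotonicity of `v / u'`. -/
theorem translationWronskian_mul (hp : 1 < p) (β : ℝ) {r : ℝ} (hr : 0 < r) (hu' : u' r ≠ 0) :
    r ^ (n - 1) * (translationWronskian n p u u' v v' r * (r * u' r + β * u r) / u' r) =
      modifiedWronskian n p β u u' v v' r + r ^ (n - 1) * (v r / u' r *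
        (2 * (1 + β) * energy p u u' r + β * ((n : ℝ) - 1) / r * (u r * u' r))) := by
  have hp' : p + 1 ≠ 0 := by linarith
  simp only [translationWronskian, modifiedWronskian, energy, F_eq hp, f_eq, scalingWronskian,
    sourcePotential]
  field_simp
  ring

end RadialPair

/-- A function whose derivative is negative at each of its zeros cannot leave the negative
half-line. -/
theorem neg_of_deriv_neg_at_zero {g g' : ℝ → ℝ} {a b : ℝ} (ha : g a ≤ 0)
    (hd : ∀ x ∈ Icc a b, HasDerivAt g (g' x) x)
    (h0 : ∀ x ∈ Icc a b, g x = 0 → g' x < 0) : ∀ x ∈ Ioc a b, g x < 0 := by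
  have hle : ∀ x ∈ Icc a b, g x ≤ 0 := fun x hx =>
    image_le_of_deriv_right_lt_deriv_boundary (B := fun _ => 0) (B' := fun _ => 0)
      (fun x hx => (hd x hx).continuousAt.continuousWithinAt)
      (fun x hx => (hd x (Ico_subset_Icc_self hx)).hasDerivWithinAt) ha
      (fun x => hasDerivAt_const x 0)
      (fun x hx => h0 x (Ico_subset_Icc_self hx)) hx
  intro x hx
  refine lt_of_le_of_ne (hle x (Ioc_subset_Icc_self hx)) fun hgx => ?_
  have h1 := h0 x (Ioc_subset_Icc_self hx) hgx
  have h2 := (hasDerivAt_iff_tendsto_slope.1 (hd x (Ioc_subset_Icc_self hx))).mono_left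
    (nhdsWithin_mono x (fun y (hy : y < x) => hy.ne) : nhdsWithin x (Iio x) ≤ _)
  refine absurd (ge_of_tendsto h2 ?_) (not_le.2 h1)
  filter_upwards [Ioo_mem_nhdsLT hx.1] with y hy
  rw [slope_def_field, hgx, sub_zero]
  exact div_nonneg_of_nonpos (hle y ⟨hy.1.le, hy.2.le.trans hx.2⟩) (by linarith [hy.2])

theorem one_lt_of_F_pos {p s : ℝ} (hp : 1 < p) (hF : 0 < F p s) :
    1 < |s| ^ (p - 1) / (p + 1) * 2 := by
  rw [F_eq hp] at hF
  have := pos_of_mul_pos_right hF (sq_nonneg s)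
  linarith

theorem one_lt_rpow_of_F_pos {p s : ℝ} (hp : 1 < p) (hF : 0 < F p s) :
    (p + 1) / 2 < |s| ^ (p - 1) := by
  have := one_lt_of_F_pos hp hF
  rw [div_mul_eq_mul_div, lt_div_iff₀ (by linarith)] at this
  linarith

theorem f_pos_of_F_pos {p s : ℝ} (hp : 1 < p) (hs : 0 < s) (hF : 0 < F p s) : 0 < f p s := by
  have := one_lt_rpow_of_F_pos hp hF
  rw [f_eq]
  exact mul_pos hs (by linarith)

theorem F_mono {p s t : ℝ} (hp : 1 < p) (ht : 0 < F p s) (hst : |s| ≤ |t|) : F p s ≤ F p t := by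
  have h1 := one_lt_rpow_of_F_pos hp ht
  have h2 : |s| ^ (p - 1) ≤ |t| ^ (p - 1) :=
    Real.rpow_le_rpow (abs_nonneg _) hst (by linarith)
  rw [F_eq hp, F_eq hp] at *
  have h3 := sq_le_sq.2 hst
  have h4 : |s| ^ (p - 1) / (p + 1) ≤ |t| ^ (p - 1) / (p + 1) := by gcongr
  have h5 := pos_of_mul_pos_right ht (sq_nonneg s)
  exact mul_le_mul h3 (by linarith) h5.le (sq_nonneg t)

theorem two_F_lt {p s : ℝ} (hp : 1 < p) (hs : s ≠ 0) : 2 * F p s < s * f p s := by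
  have h1 : 0 < |s| ^ (p - 1) := Real.rpow_pos_of_pos (abs_pos.2 hs) _
  have h2 : 0 < s ^ 2 := by positivity
  have h3 : s * f p s - 2 * F p s = s ^ 2 * (|s| ^ (p - 1) * ((p - 1) / (p + 1))) := by
    have : p + 1 ≠ 0 := by linarith
    rw [F_eq hp, f_eq]; field_simp; ring
  have h4 : 0 < s ^ 2 * (|s| ^ (p - 1) * ((p - 1) / (p + 1))) := by
    have : 0 < p - 1 := by linarith
    positivity
  linarith

theorem two_F_le {p : ℝ} (hp : 1 < p) (s : ℝ) : 2 * F p s ≤ s * f p s := by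
  rcases eq_or_ne s 0 with rfl | hs
  · simp [F_eq hp]
  · exact (two_F_lt hp hs).le

theorem pohozaev_coeff_pos {n : ℕ} (hn : 3 ≤ n) {p : ℝ} (hp : 1 < p)
    (hp2 : p < ((n : ℝ) + 2) / ((n : ℝ) - 2)) :
    0 < (n : ℝ) / (p + 1) - ((n : ℝ) - 2) / 2 := by
  have hn' : (3 : ℝ) ≤ n := by exact_mod_cast hn
  rw [lt_div_iff₀ (by linarith)] at hp2
  rw [sub_pos, div_lt_div_iff₀ (by norm_num) (by linarith)]
  nlinarith

namespace RadialPair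

variable {n : ℕ} {p : ℝ} {u u' v v' : ℝ → ℝ}

theorem energy_antitone (h : RadialPair n p u u' v v') (hn : 3 ≤ n) (hp : 1 < p) {r s : ℝ}
    (hr : 0 ≤ r) (hrs : r ≤ s) : energy p u u' s ≤ energy p u u' r := by
  have hn' : (3 : ℝ) ≤ n := by exact_mod_cast hn
  refine ge_of_hasDerivAt_nonpos hrs
    ((h.continuousOn_energy hp).mono fun x hx => hr.trans hx.1)
    (fun x hx => h.hasDerivAt_energy hp (hr.trans_lt hx.1)) fun x hx => ?_
  have : 0 < x := hr.trans_lt hx.1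
  have : 0 ≤ ((n : ℝ) - 1) / x * u' x ^ 2 := by
    have : 0 ≤ (n : ℝ) - 1 := by linarith
    positivity
  linarith

/-- Cauchy uniqueness: a solution that is nonzero at the origin has only simple zeros. -/
theorem deriv_ne_zero (h : RadialPair n p u u' v v') (hn : 3 ≤ n) (hp : 1 < p) (h0 : u 0 ≠ 0)
    {z : ℝ} (hz : 0 < z) (huz : u z = 0) : u' z ≠ 0 := by
  intro hu'z
  have hn' : (3 : ℝ) ≤ n := by exact_mod_cast hn
  have hzero : ∀ a ∈ Ioo 0 z, u a = 0 := by
    intro a ha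
    have hcq : ContinuousOn (fun r => |2 - |u r| ^ (p - 1)|) (Icc a z) := by
      have h1 := Real.continuous_rpow_const (by linarith : (0 : ℝ) ≤ p - 1)
      have h2 : Continuous fun s : ℝ => |2 - |s| ^ (p - 1)| := by fun_prop
      exact h2.comp_continuousOn (h.cont_u.mono fun x hx => ha.1.le.trans hx.1)
    obtain ⟨M, hM⟩ := isCompact_Icc.bddAbove_image hcq
    have hM' : ∀ r ∈ Icc a z, |2 - |u r| ^ (p - 1)| ≤ M := fun r hr =>
      hM (mem_image_of_mem _ hr)
    set C := M + 2 * (((n : ℝ) - 1) / a) with hC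
    have hmono : (u a ^ 2 + u' a ^ 2) * exp (C * a) ≤ (u z ^ 2 + u' z ^ 2) * exp (C * z) := by
      refine le_of_hasDerivAt_nonneg (g := fun r => (u r ^ 2 + u' r ^ 2) * exp (C * r)) ha.2.le
        ?_ (fun x hx => ((((h.deriv_u x (ha.1.trans hx.1)).pow 2).add
          ((h.deriv_u' x (ha.1.trans hx.1)).pow 2)).mul
          (((hasDerivAt_id x).const_mul C).exp))) fun x hx => ?_
      · have h1 := h.cont_u.mono fun x (hx : x ∈ Icc a z) => ha.1.le.trans hx.1
        have h2 := h.cont_u'.mono fun x (hx : x ∈ Icc a z) => ha.1.le.trans hx.1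
        fun_prop
      · have hx0 : 0 < x := ha.1.trans hx.1
        have hMx := hM' x ⟨hx.1.le, hx.2.le⟩
        have h1 : 2 * (u x * u' x) * (2 - |u x| ^ (p - 1)) ≥ -(M * (u x ^ 2 + u' x ^ 2)) := by
          have e1 := abs_le.1 (le_refl |2 * (u x * u' x) * (2 - |u x| ^ (p - 1))|)
          rw [abs_mul] at e1
          have e2 : |2 * (u x * u' x)| ≤ u x ^ 2 + u' x ^ 2 :=
            abs_le.2 ⟨by nlinarith [sq_nonneg (u x + u' x)], by nlinarith [sq_nonneg (u x - u' x)]⟩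
          have e3 : |2 * (u x * u' x)| * |2 - |u x| ^ (p - 1)| ≤ (u x ^ 2 + u' x ^ 2) * M :=
            mul_le_mul e2 hMx (abs_nonneg _) (by positivity)
          linarith [e1.1]
        have h2 : ((n : ℝ) - 1) / x * u' x ^ 2 ≤ ((n : ℝ) - 1) / a * (u x ^ 2 + u' x ^ 2) := by
          have e1 : ((n : ℝ) - 1) / x ≤ ((n : ℝ) - 1) / a :=
            div_le_div_of_nonneg_left (by linarith) ha.1 hx.1.le
          have e2 : 0 ≤ ((n : ℝ) - 1) / x := div_nonneg (by linarith) hx0.le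
          exact mul_le_mul e1 (by nlinarith [sq_nonneg (u x)]) (sq_nonneg _) (e2.trans e1)
        have h3 : 0 < exp (C * x) := exp_pos _
        have h4 : 0 ≤ 2 * (u x * u' x) * (2 - |u x| ^ (p - 1))
            - 2 * (((n : ℝ) - 1) / x * u' x ^ 2) + C * (u x ^ 2 + u' x ^ 2) := by
          rw [hC]; linarith
        have h5 := mul_nonneg h4 h3.le
        simp only [f_eq, id, Pi.add_apply, Pi.pow_apply]
        norm_num
        linarith
    rw [huz, hu'z] at hmono
    have h1 : 0 < exp (C * a) := exp_pos _
    have h2 : u a ^ 2 + u' a ^ 2 ≤ 0 := by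
      by_contra! hcon
      have := mul_pos hcon h1
      norm_num at hmono
      linarith
    nlinarith [sq_nonneg (u a), sq_nonneg (u' a)]
  have h1 : Tendsto u (nhdsWithin 0 (Ioi 0)) (nhds (u 0)) :=
    (h.cont_u 0 self_mem_Ici).mono_left (nhdsWithin_mono _ Ioi_subset_Ici_self)
  refine h0 (tendsto_nhds_unique h1 (tendsto_const_nhds.congr' ?_))
  filter_upwards [Ioo_mem_nhdsGT hz] with a ha using (hzero a ha).symm

theorem energy_pos (h : RadialPair n p u u' v v') (hn : 3 ≤ n) (hp : 1 < p) (h0 : u 0 ≠ 0)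
    {r z : ℝ} (hz : 0 < z) (huz : u z = 0) (hr : 0 ≤ r) (hrz : r ≤ z) : 0 < energy p u u' r := by
  refine lt_of_lt_of_le ?_ (h.energy_antitone hn hp hr hrz)
  have := h.deriv_ne_zero hn hp h0 hz huz
  rw [energy, huz, F_eq hp]
  have : 0 < u' z ^ 2 := by positivity
  simp
  linarith

theorem deriv_neg_after (h : RadialPair n p u u' v v') (hp : 1 < p) {a b : ℝ} (ha : 0 < a)
    (hE : ∀ r ∈ Icc a b, 0 < energy p u u' r) (hu : ∀ r ∈ Icc a b, 0 < u r) (hua : u' a ≤ 0) :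
    ∀ r ∈ Ioc a b, u' r < 0 := by
  refine neg_of_deriv_neg_at_zero hua (fun x hx => h.deriv_u' x (ha.trans_le hx.1))
    fun x hx hx0 => ?_
  have h1 := hE x hx
  rw [energy, hx0] at h1
  have := f_pos_of_F_pos hp (hu x hx) (by linarith)
  rw [hx0]
  linarith

end RadialPair

/-- `u` decreases from the critical point `c` to its next zero `z`, with positive energy. -/
structure Descent (p : ℝ) (u u' : ℝ → ℝ) (c z : ℝ) : Prop where
  nonneg : 0 ≤ c
  lt : c < z
  pos : ∀ r ∈ Ico c z, 0 < u r
  zero : u z = 0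
  crit : u' c = 0
  neg : ∀ r ∈ Ioc c z, u' r < 0
  energy_pos : ∀ r ∈ Icc c z, 0 < energy p u u' r

namespace RadialPair

variable {n : ℕ} {p : ℝ} {u u' v v' : ℝ → ℝ} {c z : ℝ}

theorem descent_lt (h : RadialPair n p u u' v v') (d : Descent p u u' c z) {x y : ℝ} (hx : c ≤ x)
    (hxy : x < y) (hy : y ≤ z) : u y < u x :=
  gt_of_hasDerivAt_neg hxy (h.cont_u.mono fun _ hr => d.nonneg.trans (hx.trans hr.1))
    (fun r hr => h.deriv_u r (d.nonneg.trans_lt (hx.trans_lt hr.1)))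
    fun r hr => d.neg r ⟨hx.trans_lt hr.1, hr.2.le.trans hy⟩

theorem descent_nonneg (d : Descent p u u' c z) {x : ℝ} (hx : c ≤ x) (hxz : x ≤ z) : 0 ≤ u x := by
  rcases hxz.lt_or_eq with h1 | rfl
  · exact (d.pos x ⟨hx, h1⟩).le
  · exact d.zero.ge

theorem descent_rpow_lt (h : RadialPair n p u u' v v') (hp : 1 < p) (d : Descent p u u' c z)
    {x y : ℝ} (hx : c ≤ x) (hxy : x < y) (hy : y ≤ z) : |u y| ^ (p - 1) < |u x| ^ (p - 1) := by
  have h1 := descent_nonneg d (hx.trans hxy.le) hy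
  have h2 := h.descent_lt d hx hxy hy
  rw [abs_of_nonneg h1, abs_of_nonneg (h1.trans h2.le)]
  exact Real.rpow_lt_rpow h1 h2 (by linarith)

theorem pohozaev_pos (h : RadialPair n p u u' v v') (hn : 3 ≤ n) (hp : 1 < p)
    (hp2 : p < ((n : ℝ) + 2) / ((n : ℝ) - 2)) (d : Descent p u u' c z) {r : ℝ} (hcr : c < r)
    (hrz : r ≤ z) : 0 < pohozaev n p u u' r := by
  have hc0 := pohozaev_coeff_pos hn hp hp2
  have hpos : ∀ x, c < x → 0 < x := fun x hx => d.nonneg.trans_lt hx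
  by_cases hq : 0 ≤ -1 + ((n : ℝ) / (p + 1) - ((n : ℝ) - 2) / 2) * |u r| ^ (p - 1)
  · have h1 : pohozaev n p u u' c < pohozaev n p u u' r := by
      refine lt_of_hasDerivAt_pos hcr
        ((h.continuousOn_pohozaev hp).mono fun x hx => d.nonneg.trans hx.1)
        (fun x hx => h.hasDerivAt_pohozaev hn hp (hpos x hx.1)) fun x hx => ?_
      have e1 := h.descent_rpow_lt hp d hx.1.le hx.2 hrz
      have e2 := mul_lt_mul_of_pos_left e1 hc0
      have e3 := d.pos x ⟨hx.1.le, hx.2.trans_le hrz⟩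
      have e4 := hpos x hx.1
      have e5 : 0 < -1 + ((n : ℝ) / (p + 1) - ((n : ℝ) - 2) / 2) * |u x| ^ (p - 1) := by linarith
      positivity
    refine lt_of_le_of_lt ?_ h1
    have := (d.energy_pos c ⟨le_rfl, d.lt.le⟩).le
    have := d.nonneg
    rw [pohozaev, d.crit]
    simp only [mul_zero, add_zero]
    positivity
  · push Not at hq
    have h1 : pohozaev n p u u' z ≤ pohozaev n p u u' r := by
      refine ge_of_hasDerivAt_nonpos hrz
        ((h.continuousOn_pohozaev hp).mono fun x hx => (hpos r hcr).le.trans hx.1)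
        (fun x hx => h.hasDerivAt_pohozaev hn hp (hpos x (hcr.trans hx.1))) fun x hx => ?_
      have e1 := h.descent_rpow_lt hp d hcr.le hx.1 hx.2.le
      have e2 := mul_lt_mul_of_pos_left e1 hc0
      have e4 := hpos x (hcr.trans hx.1)
      exact mul_nonpos_of_nonneg_of_nonpos (by positivity)
        (mul_nonpos_of_nonneg_of_nonpos (by positivity) (by linarith))
    refine lt_of_lt_of_le ?_ h1
    have := d.energy_pos z ⟨d.lt.le, le_rfl⟩
    have := hpos z d.lt
    rw [pohozaev, d.zero]
    simp only [zero_mul, mul_zero, add_zero]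
    positivity

theorem hasDerivAt_ratio (h : RadialPair n p u u' v v') {r : ℝ} (hr : 0 < r) (hur : u r ≠ 0) :
    HasDerivAt (fun x => -(x * u' x) / u x)
      (((2 * r * energy p u u' r + ((n : ℝ) - 2) * (u r * u' r)) +
        r * (u r * f p (u r) - 2 * F p (u r))) / u r ^ 2) r := by
  refine (((hasDerivAt_id r).mul (h.deriv_u' r hr)).neg.div
    (h.deriv_u r hr) hur).congr_deriv ?_
  simp only [energy, id, Pi.neg_apply, Pi.mul_apply]
  field_simp
  ring

theorem pohozaev_density_pos (h : RadialPair n p u u' v v') (hn : 3 ≤ n) (hp : 1 < p)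
    (hp2 : p < ((n : ℝ) + 2) / ((n : ℝ) - 2)) (d : Descent p u u' c z) {r : ℝ} (hcr : c < r)
    (hrz : r ≤ z) : 0 < 2 * r * energy p u u' r + ((n : ℝ) - 2) * (u r * u' r) := by
  have h1 := h.pohozaev_pos hn hp hp2 d hcr hrz
  have h2 : 0 < r := d.nonneg.trans_lt hcr
  rw [pohozaev] at h1
  have := pos_of_mul_pos_right h1 (by positivity)
  linarith

theorem ratio_lt (h : RadialPair n p u u' v v') (hn : 3 ≤ n) (hp : 1 < p)
    (hp2 : p < ((n : ℝ) + 2) / ((n : ℝ) - 2)) (d : Descent p u u' c z) {x y : ℝ} (hx : c ≤ x)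
    (hxy : x < y) (hy : y < z) : -(x * u' x) / u x < -(y * u' y) / u y := by
  have h0 : ∀ r ∈ Icc x y, 0 < u r := fun r hr => d.pos r ⟨hx.trans hr.1, hr.2.trans_lt hy⟩
  refine lt_of_hasDerivAt_pos (g := fun r => -(r * u' r) / u r) hxy ?_
    (fun r hr => h.hasDerivAt_ratio (d.nonneg.trans_lt (hx.trans_lt hr.1))
      (h0 r (Ioo_subset_Icc_self hr)).ne') fun r hr => ?_
  · have hs : Icc x y ⊆ Ici 0 := fun r hr => d.nonneg.trans (hx.trans hr.1)
    exact ((continuousOn_id.mul (h.cont_u'.mono hs)).neg).div (h.cont_u.mono hs)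
      fun r hr => (h0 r hr).ne'
  · have h1 := h.pohozaev_density_pos hn hp hp2 d (hx.trans_lt hr.1) (hr.2.le.trans hy.le)
    have h2 := h0 r (Ioo_subset_Icc_self hr)
    have h3 := two_F_lt hp h2.ne'
    have h4 : 0 < r := d.nonneg.trans_lt (hx.trans_lt hr.1)
    have h5 := mul_pos h4 (sub_pos.2 h3)
    positivity

theorem scaling_neg_after (h : RadialPair n p u u' v v') (hn : 3 ≤ n) (hp : 1 < p)
    (hp2 : p < ((n : ℝ) + 2) / ((n : ℝ) - 2)) (d : Descent p u u' c z) {x y β : ℝ} (hx : c ≤ x)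
    (hβ : β = -(x * u' x) / u x) (hxy : x < y) (hy : y ≤ z) : y * u' y + β * u y < 0 := by
  rcases hy.lt_or_eq with hy | rfl
  · have h1 := h.ratio_lt hn hp hp2 d hx hxy hy
    rw [← hβ, lt_div_iff₀ (d.pos y ⟨hx.trans hxy.le, hy⟩)] at h1
    linarith
  · rw [d.zero, mul_zero, add_zero]
    exact mul_neg_of_pos_of_neg (d.nonneg.trans_lt d.lt) (d.neg y ⟨d.lt, le_rfl⟩)

/-- Positivity of the remainder in `translationWronskian_mul` past a point where
`-(r u') / u = β`. -/
theorem remainder_pos (h : RadialPair n p u u' v v') (hn : 3 ≤ n) (hp : 1 < p)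
    (hp2 : p < ((n : ℝ) + 2) / ((n : ℝ) - 2)) (d : Descent p u u' c z) {x r β : ℝ} (hx : c < x)
    (hβ : β = -(x * u' x) / u x) (hβ0 : 0 ≤ β) (hxr : x < r) (hrz : r ≤ z) :
    0 < 2 * (1 + β) * energy p u u' r + β * ((n : ℝ) - 1) / r * (u r * u' r) := by
  have hn' : (3 : ℝ) ≤ n := by exact_mod_cast hn
  have hr : 0 < r := d.nonneg.trans_lt (hx.trans hxr)
  suffices hs : 0 < 2 * (1 + β) * r ^ 2 * energy p u u' r + β * ((n : ℝ) - 1) * r * (u r * u' r) by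
    have e : 2 * (1 + β) * energy p u u' r + β * ((n : ℝ) - 1) / r * (u r * u' r) =
      (2 * (1 + β) * r ^ 2 * energy p u u' r + β * ((n : ℝ) - 1) * r * (u r * u' r)) / r ^ 2 := by
      field_simp
    rw [e]
    positivity
  rcases le_total β ((n : ℝ) - 2) with hb | hb
  · have h1 := h.pohozaev_density_pos hn hp hp2 d (hx.trans hxr) hrz
    have h2 := descent_nonneg d (hx.trans hxr).le hrz
    have h3 := d.neg r ⟨hx.trans hxr, hrz⟩
    have h4 : 0 ≤ u r * -u' r := mul_nonneg h2 (by linarith)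
    have h5 : 0 ≤ (u r * -u' r) * (((n : ℝ) - 2) - β) * r :=
      mul_nonneg (mul_nonneg h4 (by linarith)) hr.le
    have h6 : 0 < (1 + β) * r * (2 * r * energy p u u' r + ((n : ℝ) - 2) * (u r * u' r)) :=
      mul_pos (by positivity) h1
    linarith
  · obtain ⟨κ, hκ⟩ : ∃ κ, κ = ((n : ℝ) - 1) * β / (1 + β) := ⟨_, rfl⟩
    have hκ2 : (n : ℝ) - 2 ≤ κ := by
      rw [hκ, le_div_iff₀ (by linarith)]
      linarith
    have hmono : z ^ (κ - 2) *
        (2 * (1 + β) * z ^ 2 * energy p u u' z + β * ((n : ℝ) - 1) * z * (u z * u' z)) ≤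
        r ^ (κ - 2) *
        (2 * (1 + β) * r ^ 2 * energy p u u' r + β * ((n : ℝ) - 1) * r * (u r * u' r)) := by
      have hpos : ∀ y ∈ Icc r z, 0 < y := fun y hy => hr.trans_le hy.1
      have hd : ∀ y ∈ Icc r z, HasDerivAt (fun y => y ^ (κ - 2) *
          (2 * (1 + β) * y ^ 2 * energy p u u' y + β * ((n : ℝ) - 1) * y * (u y * u' y))) _ y :=
        fun y hy => (Real.hasDerivAt_rpow_const (Or.inl (hpos y hy).ne')).mul
          ((((hasDerivAt_pow 2 y).const_mul (2 * (1 + β))).mul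
            (h.hasDerivAt_energy hp (hpos y hy))).add
          (((hasDerivAt_id y).const_mul (β * ((n : ℝ) - 1))).mul
            ((h.deriv_u y (hpos y hy)).mul (h.deriv_u' y (hpos y hy)))))
      refine ge_of_hasDerivAt_nonpos hrz
        (fun y hy => (hd y hy).continuousAt.continuousWithinAt)
        (fun y hy => hd y (Ioo_subset_Icc_self hy)) fun y hy => ?_
      have hy0 := hpos y (Ioo_subset_Icc_self hy)
      have e1 := (h.scaling_neg_after hn hp hp2 d hx.le hβ (hxr.trans hy.1) hy.2.le).le
      have e2 := two_F_le hp (u y)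
      have e3 := descent_nonneg d (hx.trans (hxr.trans hy.1)).le hy.2.le
      have e4 : 0 < y ^ (κ - 2) := Real.rpow_pos_of_pos hy0 _
      set m := -(y * u' y) with hm
      have e5 : β * u y ≤ m := by rw [hm]; linarith
      have e6 : 0 ≤ β * u y := mul_nonneg hβ0 e3
      have e7 : β * u y * ((n : ℝ) - κ) ≤ 2 * m := by
        rcases le_total ((n : ℝ) - κ) 0 with hk | hk
        · exact (mul_nonpos_of_nonneg_of_nonpos e6 hk).trans (by linarith)
        · have : β * u y * ((n : ℝ) - κ) ≤ β * u y * 2 :=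
            mul_le_mul_of_nonneg_left (by linarith) e6
          linarith
      have e8 : 0 ≤ (2 * m - β * u y * ((n : ℝ) - κ)) * m := mul_nonneg (by linarith) (by linarith)
      have hκ4 : κ * (1 + β) = ((n : ℝ) - 1) * β := by rw [hκ]; field_simp
      have e9 : 0 ≤ ((n : ℝ) - 1) * ((2 * m - β * u y * ((n : ℝ) - κ)) * m) +
          β * ((n : ℝ) - 1) * y ^ 2 * (u y * f p (u y) - 2 * F p (u y)) :=
        add_nonneg (mul_nonneg (by linarith) e8) (mul_nonneg (mul_nonneg (mul_nonneg hβ0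
          (by linarith)) (sq_nonneg y)) (by linarith))
      have e10 : 0 ≤ y ^ (κ - 2) / y := by positivity
      refine le_of_eq_of_le ?_ (neg_nonpos.2 (mul_nonneg e10 e9))
      rw [Real.rpow_sub_one hy0.ne', hm]
      simp only [energy, id]
      field_simp
      linear_combination (y * u' y ^ 2 + 2 * y * F p (u y)) * hκ4
    have h1 := d.energy_pos z ⟨d.lt.le, le_rfl⟩
    have hz : 0 < z := d.nonneg.trans_lt d.lt
    rw [d.zero] at hmono
    simp only [zero_mul, mul_zero, add_zero] at hmono
    have h2 : 0 < z ^ (κ - 2) := Real.rpow_pos_of_pos hz _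
    have h3 : 0 < r ^ (κ - 2) := Real.rpow_pos_of_pos hr _
    have h4 : 0 < z ^ (κ - 2) * (2 * (1 + β) * z ^ 2 * energy p u u' z) := by positivity
    exact pos_of_mul_pos_right (h4.trans_le hmono) h3.le

end RadialPair

/-- The exponent `β` at which the source potential vanishes at `s`. -/
noncomputable def criticalExponent (p s : ℝ) : ℝ := (2 - (p + 1) / |s| ^ (p - 1)) / (p - 1)

theorem criticalExponent_spec {p s : ℝ} (hp : 1 < p) (hs : s ≠ 0) :
    (2 - criticalExponent p s * (p - 1)) * |s| ^ (p - 1) = p + 1 := by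
  have h1 : 0 < |s| ^ (p - 1) := Real.rpow_pos_of_pos (abs_pos.2 hs) _
  have h2 : p - 1 ≠ 0 := by linarith
  rw [criticalExponent]
  field_simp
  ring

theorem criticalExponent_lt {p s t : ℝ} (hp : 1 < p) (hs : s ≠ 0) (hst : |s| < |t|) :
    criticalExponent p s < criticalExponent p t := by
  have h1 : 0 < |s| ^ (p - 1) := Real.rpow_pos_of_pos (abs_pos.2 hs) _
  have h2 : |s| ^ (p - 1) < |t| ^ (p - 1) :=
    Real.rpow_lt_rpow (abs_nonneg _) hst (by linarith)
  have h3 : (p + 1) / |t| ^ (p - 1) < (p + 1) / |s| ^ (p - 1) :=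
    div_lt_div_of_pos_left (by linarith) h1 h2
  exact div_lt_div_of_pos_right (by linarith) (by linarith)

theorem criticalExponent_neg (p s : ℝ) : criticalExponent p (-s) = criticalExponent p s := by
  simp [criticalExponent]

theorem le_of_criticalExponent_le {p s β : ℝ} (hp : 1 < p) (hs : s ≠ 0)
    (hβ : criticalExponent p s ≤ β) : (2 - β * (p - 1)) / (p + 1) * |s| ^ (p - 1) ≤ 1 := by
  have h1 : 0 < |s| ^ (p - 1) := Real.rpow_pos_of_pos (abs_pos.2 hs) _
  rw [div_mul_eq_mul_div, div_le_one (by linarith), ← criticalExponent_spec hp hs]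
  have : 0 < p - 1 := by linarith
  gcongr

theorem lt_of_lt_criticalExponent {p s β : ℝ} (hp : 1 < p) (hs : s ≠ 0)
    (hβ : β < criticalExponent p s) : 1 < (2 - β * (p - 1)) / (p + 1) * |s| ^ (p - 1) := by
  have h1 : 0 < |s| ^ (p - 1) := Real.rpow_pos_of_pos (abs_pos.2 hs) _
  rw [div_mul_eq_mul_div, one_lt_div (by linarith), ← criticalExponent_spec hp hs]
  have : 0 < p - 1 := by linarith
  gcongr

theorem two_le_of_le_criticalExponent {p s β : ℝ} (hp : 1 < p) (hs : s ≠ 0)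
    (hβ : β ≤ criticalExponent p s) : 2 ≤ (2 - β * (p - 1)) * |s| ^ (p - 1) := by
  have h1 : 0 < |s| ^ (p - 1) := Real.rpow_pos_of_pos (abs_pos.2 hs) _
  have h2 := criticalExponent_spec hp hs
  have h3 : (2 - criticalExponent p s * (p - 1)) * |s| ^ (p - 1) ≤
      (2 - β * (p - 1)) * |s| ^ (p - 1) := by
    have : 0 < p - 1 := by linarith
    gcongr
  linarith

theorem criticalExponent_pos_of_F_pos {p s : ℝ} (hp : 1 < p) (hF : 0 < F p s) :
    0 < criticalExponent p s := by
  have h1 := one_lt_rpow_of_F_pos hp hF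
  have h2 : (p + 1) / |s| ^ (p - 1) < 2 := by
    rw [div_lt_iff₀ (by linarith)]
    linarith
  exact div_pos (by linarith) (by linarith)

theorem scalingWronskian_eq_add {n : ℕ} {p : ℝ} (β γ : ℝ) (u u' v v' : ℝ → ℝ) (r : ℝ) :
    scalingWronskian n p β u u' v v' r =
      scalingWronskian n p γ u u' v v' r + (β - γ) * wronskian n u u' v v' r := by
  simp only [scalingWronskian, wronskian]
  ring

/-- `u` increases from its zero `a` to the critical point `c`, with positive energy. -/
structure Ascent (p : ℝ) (u u' : ℝ → ℝ) (a c : ℝ) : Prop where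
  left_pos : 0 < a
  lt : a < c
  zero : u a = 0
  pos : ∀ r ∈ Ioc a c, 0 < u r
  crit : u' c = 0
  deriv_pos : ∀ r ∈ Ico a c, 0 < u' r
  energy_pos : ∀ r ∈ Icc a c, 0 < energy p u u' r

namespace RadialPair

variable {n : ℕ} {p : ℝ} {u u' v v' : ℝ → ℝ} {a c z : ℝ}

theorem exists_first_zero (h : RadialPair n p u u' v v') (hn : 3 ≤ n) (hp : 1 < p)
    (d : Descent p u u' c z) (hvc : 0 < v c) (hU : 0 ≤ wronskian n u u' v v' c) :
    ∃ τ ∈ Ioo c z, v τ = 0 ∧ v' τ < 0 ∧ ∀ r ∈ Ico c τ, 0 < v r := by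
  have hUlt : ∀ m ∈ Ioc c z, (∀ r ∈ Ico c m, 0 < v r) → 0 < wronskian n u u' v v' m := by
    intro m hm hv
    refine hU.trans_lt (lt_of_hasDerivAt_pos hm.1
      (h.continuousOn_wronskian.mono fun x hx => d.nonneg.trans hx.1)
      (fun x hx => h.hasDerivAt_wronskian hn (d.nonneg.trans_lt hx.1)) fun x hx => ?_)
    have h1 := d.pos x ⟨hx.1.le, hx.2.trans_le hm.2⟩
    have h2 := hv x ⟨hx.1.le, hx.2⟩
    have h3 : 0 < x := d.nonneg.trans_lt hx.1
    have h4 : 0 < |u x| ^ (p - 1) := Real.rpow_pos_of_pos (abs_pos.2 h1.ne') _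
    have h5 : 0 < p - 1 := by linarith
    positivity
  have hnonneg : ∀ m ∈ Ioc c z, (∀ r ∈ Ico c m, 0 < v r) → 0 ≤ v m := by
    intro m hm hv
    have h1 : Tendsto v (nhdsWithin m (Iio m)) (nhds (v m)) :=
      (h.deriv_v m (d.nonneg.trans_lt hm.1)).continuousAt.continuousWithinAt
    refine ge_of_tendsto h1 ?_
    filter_upwards [Ico_mem_nhdsLT hm.1] with r hr using (hv r hr).le
  have hex : ¬ ∀ r ∈ Icc c z, 0 < v r := by
    intro hv
    have h1 := hUlt z ⟨d.lt, le_rfl⟩ fun r hr => hv r (Ico_subset_Icc_self hr)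
    have h2 := hv z ⟨d.lt.le, le_rfl⟩
    have h3 := d.neg z ⟨d.lt, le_rfl⟩
    rw [wronskian, d.zero, zero_mul, sub_zero] at h1
    have h4 : 0 < z := d.nonneg.trans_lt d.lt
    have h5 := pos_of_mul_pos_right h1 (by positivity)
    nlinarith
  have hstep : ∃ m ∈ Icc c z, (∀ x ∈ Ico c m, 0 < v x) ∧ v m ≤ 0 := by
    by_contra! hcon
    exact hex (pos_of_forall_pos_before (h.cont_v.mono fun x hx => d.nonneg.trans hx.1) hcon)
  obtain ⟨m, hm, hv, hvm⟩ := hstep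
  have hcm : c < m := lt_of_le_of_ne hm.1 fun e => by rw [← e] at hvm; linarith
  have h0 : v m = 0 := le_antisymm hvm (hnonneg m ⟨hcm, hm.2⟩ hv)
  have h1 := hUlt m ⟨hcm, hm.2⟩ hv
  have h2 : 0 < m := d.nonneg.trans_lt hcm
  rw [wronskian, h0, mul_zero, zero_sub] at h1
  have h3 := pos_of_mul_pos_right h1 (by positivity)
  have hmz : m < z := lt_of_le_of_ne hm.2 fun e => by
    rw [e, d.zero, zero_mul] at h3
    linarith
  have h4 := d.pos m ⟨hm.1, hmz⟩
  exact ⟨m, ⟨hcm, hmz⟩, h0, by nlinarith, hv⟩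

theorem le_ratio_of_scalingWronskian_nonpos (h : RadialPair n p u u' v v') (hn : 3 ≤ n)
    (hp : 1 < p) (d : Descent p u u' c z) {τ β : ℝ} (hτ : τ ∈ Ioo c z)
    (hv : ∀ r ∈ Ico c τ, 0 < v r) (hvτ : v τ = 0) (hv'τ : v' τ < 0)
    (hW : scalingWronskian n p β u u' v v' c ≤ 0) (hβ : 2 ≤ (2 - β * (p - 1)) * |u τ| ^ (p - 1)) :
    β ≤ -(τ * u' τ) / u τ := by
  have hτ0 : 0 < τ := d.nonneg.trans_lt hτ.1
  have huτ := d.pos τ (Ioo_subset_Ico_self hτ)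
  have hq : 0 < |u τ| ^ (p - 1) := Real.rpow_pos_of_pos (abs_pos.2 huτ.ne') _
  have hb : 0 < 2 - β * (p - 1) := by
    by_contra! hcon
    nlinarith
  have h1 : scalingWronskian n p β u u' v v' τ ≤ scalingWronskian n p β u u' v v' c := by
    refine ge_of_hasDerivAt_nonpos hτ.1.le
      ((h.continuousOn_scalingWronskian hp β).mono fun x hx => d.nonneg.trans hx.1)
      (fun x hx => h.hasDerivAt_scalingWronskian hn β (d.nonneg.trans_lt hx.1)
        (d.pos x ⟨hx.1.le, hx.2.trans hτ.2⟩)) fun x hx => ?_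
    have e1 := h.descent_rpow_lt hp d hx.1.le hx.2 hτ.2.le
    have e2 := d.pos x ⟨hx.1.le, hx.2.trans hτ.2⟩
    have e3 := hv x ⟨hx.1.le, hx.2⟩
    have e4 : 0 < x := d.nonneg.trans_lt hx.1
    have e5 := mul_lt_mul_of_pos_left e1 hb
    have e6 : 0 ≤ u x * ((2 - β * (p - 1)) * |u x| ^ (p - 1) - 2) :=
      mul_nonneg e2.le (by linarith)
    exact mul_nonpos_of_nonneg_of_nonpos (by positivity)
      (mul_nonpos_of_nonneg_of_nonpos e3.le (by linarith))
  have h2 := h1.trans hW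
  rw [scalingWronskian, hvτ, mul_zero, zero_sub] at h2
  have h3 : 0 < τ ^ (n - 1) := by positivity
  have h4 : (τ * u' τ + β * u τ) ≤ 0 := by
    by_contra! hcon
    have := mul_pos h3 (mul_pos hcon (neg_pos.2 hv'τ))
    linarith
  rw [le_div_iff₀ huτ]
  linarith

/-- Past the zero `τ` of `v` on a descent, `v` stays negative up to the zero of `u`. -/
theorem neg_after_zero (h : RadialPair n p u u' v v') (hn : 3 ≤ n) (hp : 1 < p)
    (hp2 : p < ((n : ℝ) + 2) / ((n : ℝ) - 2)) (d : Descent p u u' c z) {τ β : ℝ}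
    (hτ : τ ∈ Ioo c z) (hvτ : v τ = 0) (hv'τ : v' τ < 0) (hβ : β = -(τ * u' τ) / u τ)
    (hκ : (2 - β * (p - 1)) / (p + 1) * |u τ| ^ (p - 1) ≤ 1) :
    (∀ r ∈ Ioc τ z, v r < 0) ∧ scalingWronskian n p β u u' v v' z ≤ 0 := by
  have hn' : (3 : ℝ) ≤ n := by exact_mod_cast hn
  have hτ0 : 0 < τ := d.nonneg.trans_lt hτ.1
  have huτ := d.pos τ (Ioo_subset_Ico_self hτ)
  have hu'τ := d.neg τ ⟨hτ.1, hτ.2.le⟩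
  have hneg : ∀ r ∈ Icc τ z, u' r < 0 := fun r hr => d.neg r ⟨hτ.1.trans_le hr.1, hr.2⟩
  have hβ0 : 0 ≤ β := by
    rw [hβ]
    exact div_nonneg (by nlinarith) huτ.le
  have hsub : ∀ r, r ≤ z → Icc τ r ⊆ Ici 0 := fun r _ x hx => hτ0.le.trans hx.1
  have hs : ∀ r ∈ Ioc τ z, (∀ x ∈ Ico τ r, 0 < translationWronskian n p u u' v v' x) →
      0 < v r / u' r := by
    intro r hr he
    have h1 : v τ / u' τ < v r / u' r :=
      lt_of_hasDerivAt_pos (g := fun x => v x / u' x) hr.1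
        ((h.cont_v.mono (hsub r hr.2)).div (h.cont_u'.mono (hsub r hr.2))
          fun x hx => (hneg x ⟨hx.1, hx.2.trans hr.2⟩).ne)
        (fun x hx => h.hasDerivAt_div (hτ0.trans hx.1)
          (hneg x ⟨hx.1.le, hx.2.le.trans hr.2⟩).ne) fun x hx =>
        div_pos (he x ⟨hx.1.le, hx.2⟩)
          (by have := (hneg x ⟨hx.1.le, hx.2.le.trans hr.2⟩).ne; positivity)
    rwa [hvτ, zero_div] at h1
  have hΦ : ∀ x ∈ Ioc τ z, 0 ≤ sourcePotential p β (u x) := by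
    intro x hx
    have e1 := (h.descent_rpow_lt hp d hτ.1.le hx.1 hx.2).le
    have e0 : 0 ≤ |u x| ^ (p - 1) := Real.rpow_nonneg (abs_nonneg _) _
    refine mul_nonneg (sq_nonneg _) (sub_nonneg.2 ?_)
    rcases le_total 0 ((2 - β * (p - 1)) / (p + 1)) with hk | hk
    · exact (mul_le_mul_of_nonneg_left e1 hk).trans hκ
    · exact (mul_nonpos_of_nonpos_of_nonneg hk e0).trans zero_le_one
  have hYτ : modifiedWronskian n p β u u' v v' τ = 0 := by
    have : τ * u' τ + β * u τ = 0 := by rw [hβ]; field_simp; ring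
    rw [modifiedWronskian, scalingWronskian, hvτ, this]
    simp
  have hY : ∀ r ∈ Ioc τ z, (∀ x ∈ Ico τ r, 0 < translationWronskian n p u u' v v' x) →
      0 ≤ modifiedWronskian n p β u u' v v' r := by
    intro r hr he
    rw [← hYτ]
    refine le_of_hasDerivAt_nonneg hr.1.le (h.continuousOn_modifiedWronskian hp β (hsub r hr.2)
        fun x hx => (hneg x ⟨hx.1, hx.2.trans hr.2⟩).ne)
      (fun x hx => h.hasDerivAt_modifiedWronskian hn hp β (hτ0.trans hx.1)
        (d.pos x ⟨hτ.1.le.trans hx.1.le, hx.2.trans_le hr.2⟩)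
        (hneg x ⟨hx.1.le, hx.2.le.trans hr.2⟩).ne) fun x hx => ?_
    have e1 := he x ⟨hx.1.le, hx.2⟩
    have e2 := hs x ⟨hx.1, hx.2.le.trans hr.2⟩ fun y hy => he y ⟨hy.1, hy.2.trans hx.2⟩
    have e3 := hΦ x ⟨hx.1, hx.2.le.trans hr.2⟩
    have e4 : 0 < x := hτ0.trans hx.1
    have e5 : 0 < (n : ℝ) - 1 := by linarith
    positivity
  have he : ∀ r ∈ Icc τ z, 0 < translationWronskian n p u u' v v' r := by
    refine pos_of_forall_pos_before ((h.continuousOn_translationWronskian hp).mono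
      fun x hx => hτ0.trans_le hx.1) fun r hr hb => ?_
    rcases hr.1.eq_or_lt with rfl | hlt
    · rw [translationWronskian, hvτ, zero_mul, add_zero]
      exact mul_pos_of_neg_of_neg hu'τ hv'τ
    · have hr0 := hτ0.trans hlt
      have e1 := translationWronskian_mul (n := n) (u := u) (v := v) (v' := v') hp β hr0 (hneg r hr).ne
      have e2 := hs r ⟨hlt, hr.2⟩ hb
      have e3 := hY r ⟨hlt, hr.2⟩ hb
      have e4 := h.remainder_pos hn hp hp2 d hτ.1 hβ hβ0 hlt hr.2
      have e5 := h.scaling_neg_after hn hp hp2 d hτ.1.le hβ hlt hr.2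
      have e6 : 0 < (r * u' r + β * u r) / u' r := div_pos_of_neg_of_neg e5 (hneg r hr)
      have e7 : 0 < r ^ (n - 1) := by positivity
      have e8 := mul_pos e7 (mul_pos e2 e4)
      rw [mul_div_assoc] at e1
      exact pos_of_mul_pos_left (pos_of_mul_pos_right (by rw [e1]; linarith) e7.le) e6.le
  refine ⟨fun r hr => ?_, ?_⟩
  · have e1 := hs r hr fun x hx => he x ⟨hx.1, hx.2.le.trans hr.2⟩
    have e2 := hneg r (Ioc_subset_Icc_self hr)
    by_contra! hcon
    exact absurd e1 (not_lt.2 (div_nonpos_of_nonneg_of_nonpos hcon e2.le))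
  · have e1 := hY z ⟨hτ.2, le_rfl⟩ fun x hx => he x (Ico_subset_Icc_self hx)
    rw [modifiedWronskian, d.zero] at e1
    simp only [sourcePotential] at e1
    norm_num at e1
    exact e1

end RadialPair

namespace RadialPair

variable {n : ℕ} {p : ℝ} {u u' v v' : ℝ → ℝ} {a c z β : ℝ}

theorem ascent_lt (h : RadialPair n p u u' v v') (d : Ascent p u u' a c) {x y : ℝ} (hx : a ≤ x)
    (hxy : x < y) (hy : y ≤ c) : u x < u y :=
  lt_of_hasDerivAt_pos hxy (h.cont_u.mono fun _ hr => d.left_pos.le.trans (hx.trans hr.1))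
    (fun r hr => h.deriv_u r (d.left_pos.trans_le (hx.trans hr.1.le)))
    fun r hr => d.deriv_pos r ⟨hx.trans hr.1.le, hr.2.trans_le hy⟩

theorem ascent_nonneg (d : Ascent p u u' a c) {x : ℝ} (hx : a ≤ x) (hxc : x ≤ c) : 0 ≤ u x := by
  rcases hx.eq_or_lt with rfl | h1
  · exact d.zero.ge
  · exact (d.pos x ⟨h1, hxc⟩).le

theorem ascent_rpow_lt (h : RadialPair n p u u' v v') (hp : 1 < p) (d : Ascent p u u' a c)
    {x y : ℝ} (hx : a ≤ x) (hxy : x < y) (hy : y ≤ c) : |u x| ^ (p - 1) < |u y| ^ (p - 1) := by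
  have h1 := ascent_nonneg d hx (hxy.le.trans hy)
  have h2 := h.ascent_lt d hx hxy hy
  rw [abs_of_nonneg h1, abs_of_nonneg (h1.trans h2.le)]
  exact Real.rpow_lt_rpow h1 h2 (by linarith)

theorem ascent_div_pos (h : RadialPair n p u u' v v') (d : Ascent p u u' a c) (hva : 0 < v a)
    {r : ℝ} (hr : r ∈ Ico a c) (he : ∀ x ∈ Ico a r, 0 < translationWronskian n p u u' v v' x) :
    0 < v r / u' r := by
  have hsub : Icc a r ⊆ Ici 0 := fun x hx => d.left_pos.le.trans hx.1
  have hpos : ∀ x ∈ Icc a r, 0 < u' x := fun x hx => d.deriv_pos x ⟨hx.1, hx.2.trans_lt hr.2⟩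
  refine (div_pos hva (hpos a ⟨le_rfl, hr.1⟩)).trans_le ?_
  refine le_of_hasDerivAt_nonneg (g := fun x => v x / u' x) hr.1
    ((h.cont_v.mono hsub).div (h.cont_u'.mono hsub) fun x hx => (hpos x hx).ne')
    (fun x hx => h.hasDerivAt_div (d.left_pos.trans hx.1) (hpos x (Ioo_subset_Icc_self hx)).ne')
    fun x hx => (div_pos (he x ⟨hx.1.le, hx.2⟩) ?_).le
  have := hpos x (Ioo_subset_Icc_self hx)
  positivity

theorem ascent_modifiedWronskian_nonneg (h : RadialPair n p u u' v v') (hn : 3 ≤ n) (hp : 1 < p)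
    (d : Ascent p u u' a c) (hva : 0 < v a) (hκ : 1 < (2 - β * (p - 1)) / (p + 1) * |u c| ^ (p - 1))
    (hW : scalingWronskian n p β u u' v v' a ≤ 0) {r : ℝ} (hr : r ∈ Ico a c)
    (he : ∀ x ∈ Ico a r, 0 < translationWronskian n p u u' v v' x)
    (hκr : (2 - β * (p - 1)) / (p + 1) * |u r| ^ (p - 1) ≤ 1) :
    0 ≤ modifiedWronskian n p β u u' v v' r := by
  have hn' : (3 : ℝ) ≤ n := by exact_mod_cast hn
  have hsub : Icc a r ⊆ Ici 0 := fun x hx => d.left_pos.le.trans hx.1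
  have hpos : ∀ x ∈ Icc a r, 0 < u' x := fun x hx => d.deriv_pos x ⟨hx.1, hx.2.trans_lt hr.2⟩
  have hκ0 : 0 < (2 - β * (p - 1)) / (p + 1) :=
    pos_of_mul_pos_left (zero_lt_one.trans hκ) (Real.rpow_nonneg (abs_nonneg _) _)
  have hYa : 0 ≤ modifiedWronskian n p β u u' v v' a := by
    rw [modifiedWronskian, d.zero]
    simp only [sourcePotential]
    norm_num
    exact hW
  refine hYa.trans (le_of_hasDerivAt_nonneg hr.1
    (h.continuousOn_modifiedWronskian hp β hsub fun x hx => (hpos x hx).ne')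
    (fun x hx => h.hasDerivAt_modifiedWronskian hn hp β (d.left_pos.trans hx.1)
      (d.pos x ⟨hx.1, hx.2.le.trans hr.2.le⟩) (hpos x (Ioo_subset_Icc_self hx)).ne') fun x hx => ?_)
  have e1 := he x ⟨hx.1.le, hx.2⟩
  have e2 := h.ascent_div_pos d hva ⟨hx.1.le, hx.2.trans hr.2⟩ fun y hy =>
    he y ⟨hy.1, hy.2.trans hx.2⟩
  have e3 : 0 ≤ sourcePotential p β (u x) := by
    have := (h.ascent_rpow_lt hp d hx.1.le hx.2 hr.2.le).le
    exact mul_nonneg (sq_nonneg _) (sub_nonneg.2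
      ((mul_le_mul_of_nonneg_left this hκ0.le).trans hκr))
  have e4 : 0 < x := d.left_pos.trans hx.1
  have e5 : 0 < (n : ℝ) - 1 := by linarith
  positivity

theorem ascent_scalingWronskian_neg (h : RadialPair n p u u' v v') (hn : 3 ≤ n) (hp : 1 < p)
    (d : Ascent p u u' a c) (hva : 0 < v a) (hκ : 1 < (2 - β * (p - 1)) / (p + 1) * |u c| ^ (p - 1))
    (hW : scalingWronskian n p β u u' v v' a ≤ 0) {r : ℝ} (hr : r ∈ Icc a c)
    (he : ∀ x ∈ Ico a r, 0 < translationWronskian n p u u' v v' x)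
    (hκr : 1 < (2 - β * (p - 1)) / (p + 1) * |u r| ^ (p - 1)) :
    scalingWronskian n p β u u' v v' r < 0 := by
  have hκ0 : 0 < (2 - β * (p - 1)) / (p + 1) :=
    pos_of_mul_pos_left (zero_lt_one.trans hκ) (Real.rpow_nonneg (abs_nonneg _) _)
  have hcont : ContinuousOn (fun x => (2 - β * (p - 1)) / (p + 1) * |u x| ^ (p - 1)) (Icc a r) := by
    have h1 := Real.continuous_rpow_const (by linarith : (0 : ℝ) ≤ p - 1)
    have h2 : Continuous fun s : ℝ => (2 - β * (p - 1)) / (p + 1) * |s| ^ (p - 1) := by fun_prop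
    exact h2.comp_continuousOn (h.cont_u.mono fun x hx => d.left_pos.le.trans hx.1)
  have hivt : (1 : ℝ) ∈ (fun x => (2 - β * (p - 1)) / (p + 1) * |u x| ^ (p - 1)) '' Icc a r := by
    refine intermediate_value_Icc hr.1 hcont ⟨?_, hκr.le⟩
    simp only [d.zero, abs_zero]
    rw [Real.zero_rpow (by linarith)]
    norm_num
  obtain ⟨x, hx, hx1⟩ := hivt
  simp only at hx1
  have hxr : x < r := lt_of_le_of_ne hx.2 fun e => by rw [e] at hx1; linarith
  have hxc : x < c := hxr.trans_le hr.2
  have e1 := h.ascent_modifiedWronskian_nonneg hn hp d hva hκ hW ⟨hx.1, hxc⟩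
    (fun y hy => he y ⟨hy.1, hy.2.trans hxr⟩) hx1.le
  rw [modifiedWronskian, sourcePotential, hx1] at e1
  norm_num at e1
  refine lt_of_lt_of_le (gt_of_hasDerivAt_neg hxr ((h.continuousOn_scalingWronskian hp β).mono
    fun y hy => d.left_pos.le.trans (hx.1.trans hy.1))
    (fun y hy => h.hasDerivAt_scalingWronskian hn β (d.left_pos.trans_le (hx.1.trans hy.1.le))
      (d.pos y ⟨hx.1.trans_lt hy.1, hy.2.le.trans hr.2⟩)) fun y hy => ?_) e1
  have hyc : y < c := hy.2.trans_le hr.2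
  have e2 := h.ascent_rpow_lt hp d hx.1 hy.1 hyc.le
  have e3 := mul_lt_mul_of_pos_left e2 hκ0
  rw [hx1, div_mul_eq_mul_div, one_lt_div (by linarith)] at e3
  have hy0 : 0 < y := d.left_pos.trans_le (hx.1.trans hy.1.le)
  have e4 := h.ascent_div_pos d hva ⟨hx.1.trans hy.1.le, hyc⟩ fun w hw =>
    he w ⟨hw.1, hw.2.trans hy.2⟩
  have e5 := d.deriv_pos y ⟨hx.1.trans hy.1.le, hyc⟩
  have e6 : 0 < v y := by
    have := mul_pos e4 e5
    rwa [div_mul_cancel₀ _ e5.ne'] at this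
  have e7 := d.pos y ⟨hx.1.trans_lt hy.1, hyc.le⟩
  have e8 : 0 < u y * ((2 - β * (p - 1)) * |u y| ^ (p - 1) - 2) := mul_pos e7 (by linarith)
  exact mul_neg_of_pos_of_neg (by positivity) (mul_neg_of_pos_of_neg e6 (by linarith))

theorem ascent_translationWronskian_pos (h : RadialPair n p u u' v v') (hn : 3 ≤ n) (hp : 1 < p)
    (d : Ascent p u u' a c) (hva : 0 < v a) (hβ : 0 ≤ β)
    (hκ : 1 < (2 - β * (p - 1)) / (p + 1) * |u c| ^ (p - 1))
    (hW : scalingWronskian n p β u u' v v' a ≤ 0) :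
    ∀ r ∈ Ico a c, 0 < translationWronskian n p u u' v v' r := by
  have hn' : (3 : ℝ) ≤ n := by exact_mod_cast hn
  intro b hb
  refine pos_of_forall_pos_before (b := b) ((h.continuousOn_translationWronskian hp).mono
      fun x hx => d.left_pos.trans_le hx.1) (fun r hr he => ?_) b ⟨hb.1, le_rfl⟩
  have hrc : r < c := hr.2.trans_lt hb.2
  have hr0 : 0 < r := d.left_pos.trans_le hr.1
  have e0 := d.deriv_pos r ⟨hr.1, hrc⟩
  have e1 := translationWronskian_mul (n := n) (u := u) (v := v) (v' := v') hp β hr0 e0.ne'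
  have e2 := h.ascent_div_pos d hva ⟨hr.1, hrc⟩ he
  have eu := ascent_nonneg d hr.1 hrc.le
  have eE := d.energy_pos r ⟨hr.1, hrc.le⟩
  have e7 : 0 < r ^ (n - 1) := by positivity
  have e6 : 0 < (r * u' r + β * u r) / u' r := by positivity
  have hn1 : 0 < (n : ℝ) - 1 := by linarith
  rw [mul_div_assoc] at e1
  refine pos_of_mul_pos_left (pos_of_mul_pos_right (a := r ^ (n - 1)) ?_ e7.le) e6.le
  rw [e1]
  rcases le_or_gt ((2 - β * (p - 1)) / (p + 1) * |u r| ^ (p - 1)) 1 with hk | hk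
  · have e3 := h.ascent_modifiedWronskian_nonneg hn hp d hva hκ hW ⟨hr.1, hrc⟩ he hk
    have e4 : 0 < 2 * (1 + β) * energy p u u' r + β * ((n : ℝ) - 1) / r * (u r * u' r) := by
      positivity
    positivity
  · have e3 := h.ascent_scalingWronskian_neg hn hp d hva hκ hW ⟨hr.1, hrc.le⟩ he hk
    have hq0 : 0 ≤ |u r| ^ (p - 1) := Real.rpow_nonneg (abs_nonneg _) _
    have hq1 : 1 < |u r| ^ (p - 1) := by
      rw [div_mul_eq_mul_div, one_lt_div (by linarith)] at hk
      have : 0 ≤ β * (p - 1) * |u r| ^ (p - 1) :=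
        mul_nonneg (mul_nonneg hβ (by linarith)) hq0
      nlinarith
    have e4 : sourcePotential p β (u r) + (2 * (1 + β) * energy p u u' r +
        β * ((n : ℝ) - 1) / r * (u r * u' r)) = (1 + β) * u' r ^ 2 +
        β * ((n : ℝ) - 1) / r * (u r * u' r) + β * (u r ^ 2 * (|u r| ^ (p - 1) - 1)) := by
      have : p + 1 ≠ 0 := by linarith
      simp only [sourcePotential, energy, F_eq hp]
      field_simp
      ring
    have e5 : 0 < sourcePotential p β (u r) + (2 * (1 + β) * energy p u u' r +
        β * ((n : ℝ) - 1) / r * (u r * u' r)) := by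
      rw [e4]
      have : 0 < |u r| ^ (p - 1) - 1 := by linarith
      positivity
    have e8 := mul_pos e7 (mul_pos e2 e5)
    rw [modifiedWronskian]
    linarith

theorem ascent_conclusion (h : RadialPair n p u u' v v') (hn : 3 ≤ n) (hp : 1 < p)
    (d : Ascent p u u' a c) (hva : 0 < v a) (hβ : 0 ≤ β)
    (hκ : 1 < (2 - β * (p - 1)) / (p + 1) * |u c| ^ (p - 1))
    (hW : scalingWronskian n p β u u' v v' a ≤ 0) :
    (∀ r ∈ Ico a c, 0 < v r) ∧ scalingWronskian n p β u u' v v' c < 0 := by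
  have he := h.ascent_translationWronskian_pos hn hp d hva hβ hκ hW
  refine ⟨fun r hr => ?_, h.ascent_scalingWronskian_neg hn hp d hva hκ hW ⟨d.lt.le, le_rfl⟩ he hκ⟩
  have e4 := h.ascent_div_pos d hva hr fun w hw => he w ⟨hw.1, hw.2.trans hr.2⟩
  have e5 := d.deriv_pos r hr
  have := mul_pos e4 e5
  rwa [div_mul_cancel₀ _ e5.ne'] at this

/-- On an ascent starting with `v > 0` and `scalingWronskian 0 ≤ 0`, `v` stays positive up to
the critical point. -/
theorem pos_on_ascent (h : RadialPair n p u u' v v') (hn : 3 ≤ n) (hp : 1 < p)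
    (d : Ascent p u u' a c) (hva : 0 < v a)
    (hW : scalingWronskian n p 0 u u' v v' a ≤ 0) :
    (∀ r ∈ Icc a c, 0 < v r) ∧ 0 < wronskian n u u' v v' c := by
  have hc0 : 0 < c := d.left_pos.trans d.lt
  have huc := d.pos c ⟨d.lt, le_rfl⟩
  have hF : 0 < F p (u c) := by
    have := d.energy_pos c ⟨d.lt.le, le_rfl⟩
    rw [energy, d.crit] at this
    linarith
  have hκ := lt_of_lt_criticalExponent hp huc.ne' (criticalExponent_pos_of_F_pos hp hF)
  obtain ⟨h1, h2⟩ := h.ascent_conclusion hn hp d hva le_rfl hκ hW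
  have hvc : 0 < v c := by
    rw [scalingWronskian, d.crit] at h2
    have hf := f_pos_of_F_pos hp huc hF
    by_contra! hcon
    have : 0 ≤ c ^ (n - 1) * (c * f p (u c) * -v c) :=
      mul_nonneg (by positivity) (mul_nonneg (by positivity) (by linarith))
    linarith
  refine ⟨fun r hr => ?_, ?_⟩
  · rcases hr.2.eq_or_lt with rfl | hlt
    · exact hvc
    · exact h1 r ⟨hr.1, hlt⟩
  · have e1 : 0 < wronskian n u u' v v' a := by
      have := d.deriv_pos a ⟨le_rfl, d.lt⟩
      have := d.left_pos
      rw [wronskian, d.zero, zero_mul, sub_zero]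
      positivity
    refine e1.trans (lt_of_hasDerivAt_pos d.lt
      (h.continuousOn_wronskian.mono fun x hx => d.left_pos.le.trans hx.1)
      (fun x hx => h.hasDerivAt_wronskian hn (d.left_pos.trans hx.1)) fun x hx => ?_)
    have e1 := d.pos x ⟨hx.1, hx.2.le⟩
    have e2 := h1 x ⟨hx.1.le, hx.2⟩
    have e3 : 0 < x := d.left_pos.trans hx.1
    have e4 : 0 < |u x| ^ (p - 1) := Real.rpow_pos_of_pos (abs_pos.2 e1.ne') _
    have e5 : 0 < p - 1 := by linarith
    positivity

end RadialPair

theorem pow_sub_potential_le {N p : ℝ} (hN : 3 ≤ N) (hp : 1 < p) (s : ℝ) :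
    2 * F p s - (N - 2) * (s * f p s) ≤ (N - 2) * ((p - 1) / (p + 1)) := by
  have hq : 0 ≤ |s| ^ (p - 1) := Real.rpow_nonneg (abs_nonneg _) _
  have h1 : 1 + (p + 1) / 2 * (s ^ 2 - 1) ≤ s ^ 2 * |s| ^ (p - 1) := by
    have h2 := one_add_mul_self_le_rpow_one_add (s := s ^ 2 - 1) (p := (p + 1) / 2)
      (by nlinarith [sq_nonneg s]) (by linarith)
    rw [← abs_rpow_add_one hp]
    refine h2.trans_eq ?_
    rw [add_sub_cancel, ← sq_abs, ← Real.rpow_natCast, ← Real.rpow_mul (abs_nonneg s)]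
    congr 1
    push_cast
    ring
  have hδ : 0 < (p - 1) / (p + 1) := div_pos (by linarith) (by linarith)
  have hδ2 : (1 - (p - 1) / (p + 1)) * ((p + 1) / 2) = 1 := by
    have : p + 1 ≠ 0 := by linarith
    field_simp
    ring
  have hδ3 : 0 < 1 - (p - 1) / (p + 1) := by
    by_contra! hcon
    nlinarith
  have e : 2 * F p s = s ^ 2 * (-1 + (1 - (p - 1) / (p + 1)) * |s| ^ (p - 1)) := by
    have : p + 1 ≠ 0 := by linarith
    rw [F_eq hp]
    field_simp
    ring
  rw [e, f_eq]
  set δ := (p - 1) / (p + 1)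
  set y := s ^ 2 * |s| ^ (p - 1) with hy
  have hy0 : 0 ≤ y := by positivity
  have h3 : s ^ 2 - y ≤ δ * (1 - y) := by
    have h4 := mul_le_mul_of_nonneg_left h1 hδ3.le
    have h5 : (1 - δ) * (1 + (p + 1) / 2 * (s ^ 2 - 1)) = (1 - δ) + (s ^ 2 - 1) := by
      linear_combination (s ^ 2 - 1) * hδ2
    rw [h5] at h4
    linarith
  have h6 : s ^ 2 * (-1 + (1 - δ) * |s| ^ (p - 1)) - (N - 2) * (s * (s * (|s| ^ (p - 1) - 1))) =
      (N - 3) * (s ^ 2 - y) - δ * y := by rw [hy]; ring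
  rw [h6]
  have h7 := mul_le_mul_of_nonneg_left h3 (by linarith : 0 ≤ N - 3)
  have h8 : 0 ≤ (N - 3) * (δ * y) := mul_nonneg (by linarith) (by positivity)
  have h9 : 0 ≤ δ * y := by positivity
  linarith

theorem le_two_F_of_lt_criticalExponent {N p s : ℝ} (hN : 3 ≤ N) (hp : 1 < p) (hs : s ≠ 0)
    (hb : N - 2 < criticalExponent p s) : (N - 2) * ((p - 1) / (p + 1)) ≤ 2 * F p s := by
  have hq : 0 < |s| ^ (p - 1) := Real.rpow_pos_of_pos (abs_pos.2 hs) _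
  have h1 := criticalExponent_spec hp hs
  set b := criticalExponent p s
  have hδ : 0 < (p - 1) / (p + 1) := div_pos (by linarith) (by linarith)
  have e : 2 * F p s = b * ((p - 1) / (p + 1)) * (s ^ 2 * |s| ^ (p - 1)) := by
    have : p + 1 ≠ 0 := by linarith
    rw [F_eq hp]
    field_simp
    linear_combination h1
  have h2 : 1 < |s| ^ (p - 1) := by
    have : 0 ≤ b * (p - 1) * |s| ^ (p - 1) :=
      mul_nonneg (mul_nonneg (by linarith) (by linarith)) hq.le
    nlinarith
  have h3 : 1 < |s| := by
    by_contra! hcon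
    exact absurd (Real.rpow_le_one (abs_nonneg s) hcon (by linarith)) (not_le.2 h2)
  have h4 : 1 < s ^ 2 := by
    rw [← sq_abs]
    nlinarith
  have h5 : 1 ≤ s ^ 2 * |s| ^ (p - 1) := by nlinarith
  rw [e]
  have h6 : (N - 2) * ((p - 1) / (p + 1)) ≤ b * ((p - 1) / (p + 1)) :=
    mul_le_mul_of_nonneg_right hb.le hδ.le
  have h7 : 0 ≤ b * ((p - 1) / (p + 1)) := mul_nonneg (by linarith) hδ.le
  nlinarith

namespace RadialPair

variable {n : ℕ} {p : ℝ} {u u' v v' : ℝ → ℝ} {c z : ℝ}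

theorem le_ratio_of_level (h : RadialPair n p u u' v v') (hn : 3 ≤ n) (hp : 1 < p)
    (hp2 : p < ((n : ℝ) + 2) / ((n : ℝ) - 2)) {x y : ℝ} (hx : 0 < x) (hxy : x < y)
    (hux : 0 < u x) (hlev : u x = |u y|) (hu'x : u' x < 0) (hu'y : u' y = 0) (hF : 0 < F p (u y))
    (hle : ∀ r ∈ Icc x y, |u r| ≤ |u y|) : (n : ℝ) - 2 ≤ -(x * u' x) / u x := by
  have hn' : (3 : ℝ) ≤ n := by exact_mod_cast hn
  have hc0 := pohozaev_coeff_pos hn hp hp2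
  have hpos : ∀ r ∈ Icc x y, 0 < r := fun r hr => hx.trans_le hr.1
  have hd : ∀ r ∈ Icc x y, HasDerivAt
      (fun r => pohozaev n p u u' r - r ^ (n - 1) * (r * F p (u y))) _ r := fun r hr =>
    (h.hasDerivAt_pohozaev hn hp (hpos r hr)).sub ((hasDerivAt_weight hn (hpos r hr)).mul
      ((hasDerivAt_id r).mul_const (F p (u y))))
  have h1 : pohozaev n p u u' y - y ^ (n - 1) * (y * F p (u y)) ≤
      pohozaev n p u u' x - x ^ (n - 1) * (x * F p (u y)) := by
    refine ge_of_hasDerivAt_nonpos hxy.le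
      (fun r hr => (hd r hr).continuousAt.continuousWithinAt)
      (fun r hr => hd r (Ioo_subset_Icc_self hr)) fun r hr => ?_
    have hr0 := hpos r (Ioo_subset_Icc_self hr)
    have hlr := hle r (Ioo_subset_Icc_self hr)
    have e0 : 0 < r ^ (n - 1) := by positivity
    have e1 : u r ^ 2 *
      (-1 + ((n : ℝ) / (p + 1) - ((n : ℝ) - 2) / 2) * |u r| ^ (p - 1)) ≤ n * F p (u y) := by
      by_cases hs : -1 + ((n : ℝ) / (p + 1) - ((n : ℝ) - 2) / 2) * |u r| ^ (p - 1) ≤ 0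
      · exact (mul_nonpos_of_nonneg_of_nonpos (sq_nonneg _) hs).trans (by positivity)
      · push Not at hs
        have e2 : |u r| ^ (p - 1) ≤ |u y| ^ (p - 1) :=
          Real.rpow_le_rpow (abs_nonneg _) hlr (by linarith)
        have e3 := mul_le_mul_of_nonneg_left e2 hc0.le
        have e4 : u r ^ 2 ≤ u y ^ 2 := sq_le_sq.2 hlr
        have e5 : u r ^ 2 *
            (-1 + ((n : ℝ) / (p + 1) - ((n : ℝ) - 2) / 2) * |u r| ^ (p - 1)) ≤ u y ^ 2 *
            (-1 + ((n : ℝ) / (p + 1) - ((n : ℝ) - 2) / 2) * |u y| ^ (p - 1)) :=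
          mul_le_mul e4 (by linarith) hs.le (sq_nonneg _)
        have e6 := one_lt_rpow_of_F_pos hp hF
        have e7 : n * F p (u y) - u y ^ 2 *
            (-1 + ((n : ℝ) / (p + 1) - ((n : ℝ) - 2) / 2) * |u y| ^ (p - 1)) =
            u y ^ 2 * (((n : ℝ) - 2) / 2 * (|u y| ^ (p - 1) - 1)) := by
          rw [F_eq hp]
          ring
        have e8 : 0 ≤ u y ^ 2 * (((n : ℝ) - 2) / 2 * (|u y| ^ (p - 1) - 1)) :=
          mul_nonneg (sq_nonneg _) (mul_nonneg (by linarith) (by linarith))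
        linarith
    have e9 := mul_nonneg e0.le (sub_nonneg.2 e1)
    refine le_of_eq_of_le ?_ (neg_nonpos.2 e9)
    field_simp
    ring
  have h2 : pohozaev n p u u' y - y ^ (n - 1) * (y * F p (u y)) = 0 := by
    rw [pohozaev, energy, hu'y]
    ring
  have h3 : F p (u x) = F p (u y) := by
    rw [hlev]
    rcases abs_choice (u y) with e | e <;> rw [e]
    exact F_neg _ _
  have h4 : pohozaev n p u u' x - x ^ (n - 1) * (x * F p (u y)) =
      x ^ (n - 1) / 2 * (u' x * (x * u' x + ((n : ℝ) - 2) * u x)) := by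
    rw [pohozaev, energy, h3]
    ring
  rw [h2, h4] at h1
  have h5 : 0 < x ^ (n - 1) / 2 := by positivity
  have h6 := nonneg_of_mul_nonneg_right h1 h5
  rw [le_div_iff₀ hux]
  by_contra! hcon
  nlinarith

theorem sq_ratio_le (h : RadialPair n p u u' v v') (hn : 3 ≤ n) (hp : 1 < p)
    {x y : ℝ} (hx : 0 < x) (hxy : x < y) (hux : u x ≠ 0) (hlev : |u x| = |u y|)
    (hb : (n : ℝ) - 2 < criticalExponent p (u x)) :
    (((n : ℝ) - 2) - -(y * u' y) / u y) ^ 2 ≤ (((n : ℝ) - 2) - -(x * u' x) / u x) ^ 2 := by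
  have hn' : (3 : ℝ) ≤ n := by exact_mod_cast hn
  have hpos : ∀ r ∈ Icc x y, 0 < r := fun r hr => hx.trans_le hr.1
  have huy : u y ≠ 0 := fun e => hux (by rw [e, abs_zero] at hlev; exact abs_eq_zero.1 hlev)
  have hF : F p (u y) = F p (u x) := by
    rw [F, F, ← sq_abs (u x), ← sq_abs (u y), hlev]
  have hd : ∀ r ∈ Icc x y, HasDerivAt
      (fun r => (r * u' r + ((n : ℝ) - 2) * u r) ^ 2 / 2 + r ^ 2 * (F p (u r) - F p (u x))) _ r :=
    fun r hr => (((((hasDerivAt_id r).mul (h.deriv_u' r (hpos r hr))).add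
      ((h.deriv_u r (hpos r hr)).const_mul ((n : ℝ) - 2))).pow 2).div_const 2).add
      ((hasDerivAt_pow 2 r).mul
        (((hasDerivAt_F hp (u r)).comp r (h.deriv_u r (hpos r hr))).sub_const (F p (u x))))
  have h1 : (y * u' y + ((n : ℝ) - 2) * u y) ^ 2 / 2 + y ^ 2 * (F p (u y) - F p (u x)) ≤
      (x * u' x + ((n : ℝ) - 2) * u x) ^ 2 / 2 + x ^ 2 * (F p (u x) - F p (u x)) := by
    refine ge_of_hasDerivAt_nonpos hxy.le
      (fun r hr => (hd r hr).continuousAt.continuousWithinAt)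
      (fun r hr => hd r (Ioo_subset_Icc_self hr)) fun r hr => ?_
    have hr0 := hpos r (Ioo_subset_Icc_self hr)
    have e1 := pow_sub_potential_le hn' hp (u r)
    have e2 := le_two_F_of_lt_criticalExponent hn' hp hux hb
    have e3 : 0 ≤ r * (2 * F p (u x) - (2 * F p (u r) - ((n : ℝ) - 2) * (u r * f p (u r)))) :=
      mul_nonneg hr0.le (by linarith)
    refine le_of_eq_of_le ?_ (neg_nonpos.2 e3)
    simp only [id, Pi.add_apply, Pi.mul_apply]
    norm_num
    field_simp
    ring
  rw [hF, sub_self, mul_zero, mul_zero, add_zero, add_zero] at h1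
  have h2 : ∀ r, u r ≠ 0 → (r * u' r + ((n : ℝ) - 2) * u r) ^ 2 / 2 =
      u r ^ 2 / 2 * (((n : ℝ) - 2) - -(r * u' r) / u r) ^ 2 := by
    intro r hr
    field_simp
    ring
  rw [h2 x hux, h2 y huy, ← sq_abs (u x), ← sq_abs (u y), hlev] at h1
  have h3 : 0 < |u y| ^ 2 / 2 := by positivity
  exact le_of_mul_le_mul_left h1 h3

/-- The ratio `-(r u') / u` at a level `|u| = X` attained on two consecutive nodal intervals
cannot exceed its value at a lower level of the first one when `X` is large. -/
theorem ratio_comparison (h : RadialPair n p u u' v v') (hn : 3 ≤ n) (hp : 1 < p)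
    (hp2 : p < ((n : ℝ) + 2) / ((n : ℝ) - 2)) (d : Descent p u u' c z) {τ y t : ℝ}
    (hτ : τ ∈ Ioo c z) (hy : z ≤ y) (hyt : y < t) (hu'y : u' y = 0) (hF : 0 < F p (u y))
    (hle : ∀ r ∈ Icc z y, |u r| ≤ |u y|) (hyc : |u y| < u c) (hty : |u t| < |u y|)
    (hτt : u τ < |u t|) (hb : -(τ * u' τ) / u τ < criticalExponent p (u t)) :
    -(t * u' t) / u t < -(τ * u' τ) / u τ := by
  have hτu := d.pos τ (Ioo_subset_Ico_self hτ)
  have hcont : ContinuousOn u (Icc c τ) := h.cont_u.mono fun x hx => d.nonneg.trans hx.1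
  have hlevel : ∀ s, u τ < s → s < u c → ∃ x ∈ Ioo c τ, u x = s := fun s hs1 hs2 =>
    intermediate_value_Ioo' hτ.1.le hcont ⟨hs1, hs2⟩
  obtain ⟨x, hx, hxs⟩ := hlevel _ hτt (hty.trans hyc)
  obtain ⟨w, hw, hws⟩ := hlevel _ (hτt.trans hty) hyc
  have hwx : w < x := by
    by_contra! hcon
    rcases hcon.eq_or_lt with rfl | hlt
    · rw [hxs] at hws
      linarith
    · have := h.descent_lt d hx.1.le hlt (hw.2.le.trans hτ.2.le)
      linarith
  have hwz : w < z := hw.2.trans hτ.2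
  have hw0 : 0 < w := d.nonneg.trans_lt hw.1
  have h1 := h.le_ratio_of_level hn hp hp2 hw0 (hwz.trans_le hy)
    (d.pos w ⟨hw.1.le, hwz⟩) hws (d.neg w ⟨hw.1, hwz.le⟩) hu'y hF (fun r hr => by
      rcases le_total z r with hzr | hzr
      · exact hle r ⟨hzr, hr.2⟩
      · rw [abs_of_nonneg (descent_nonneg d (hw.1.le.trans hr.1) hzr), ← hws]
        rcases hr.1.eq_or_lt with rfl | hlt
        · exact le_rfl
        · exact (h.descent_lt d hw.1.le hlt hzr).le)
  have h2 := h.ratio_lt hn hp hp2 d hw.1.le hwx (hx.2.trans hτ.2)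
  have h3 := h.ratio_lt hn hp hp2 d hx.1.le hx.2 hτ.2
  have hux := d.pos x ⟨hx.1.le, hx.2.trans hτ.2⟩
  have hlev : |u x| = |u t| := by rw [hxs, abs_abs]
  have hbx : criticalExponent p (u x) = criticalExponent p (u t) := by
    rw [criticalExponent, criticalExponent, hlev]
  have h4 := h.sq_ratio_le hn hp (hw0.trans hwx)
    ((hx.2.trans hτ.2).trans (hy.trans_lt hyt)) hux.ne' hlev (by rw [hbx]; linarith)
  by_contra! hcon
  nlinarith

end RadialPair

theorem scalingWronskian_neg (n : ℕ) (p β : ℝ) (u u' v v' : ℝ → ℝ) (r : ℝ) :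
    scalingWronskian n p β (fun r => -u r) (fun r => -u' r) (fun r => -v r) (fun r => -v' r) r =
      scalingWronskian n p β u u' v v' r := by
  simp only [scalingWronskian, f_neg]
  ring

theorem energy_neg (p : ℝ) (u u' : ℝ → ℝ) (r : ℝ) :
    energy p (fun r => -u r) (fun r => -u' r) r = energy p u u' r := by
  simp [energy, F_neg]

/-- A descent of `u` containing a first zero `τ` of `v` at which `-(r u') / u` is supercritical. -/
structure GoodDescent (p : ℝ) (u u' v v' : ℝ → ℝ) (c z τ : ℝ) : Prop where
  descent : Descent p u u' c z
  mem : τ ∈ Ioo c z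
  zero : v τ = 0
  deriv_neg : v' τ < 0
  pos : ∀ r ∈ Ico c τ, 0 < v r
  crit : criticalExponent p (u τ) ≤ -(τ * u' τ) / u τ

namespace RadialPair

variable {n : ℕ} {p : ℝ} {u u' v v' : ℝ → ℝ} {a c z : ℝ}

theorem exists_goodDescent_zero (h : RadialPair n p u u' v v') (hn : 3 ≤ n) (hp : 1 < p)
    (d : Descent p u u' 0 z) (hv : 0 < v 0) : ∃ τ, GoodDescent p u u' v v' 0 z τ := by
  have h0 : (0 : ℝ) ^ (n - 1) = 0 := zero_pow (by omega)
  obtain ⟨τ, hτ, h1, h2, h3⟩ := h.exists_first_zero hn hp d hv (by rw [wronskian, h0, zero_mul])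
  refine ⟨τ, d, hτ, h1, h2, h3, ?_⟩
  exact h.le_ratio_of_scalingWronskian_nonpos hn hp d hτ h3 h1 h2
    (by rw [scalingWronskian, h0, zero_mul])
    (two_le_of_le_criticalExponent hp (d.pos τ (Ioo_subset_Ico_self hτ)).ne' le_rfl)

theorem abs_lt_of_critical_points (h : RadialPair n p u u' v v') (hn : 3 ≤ n) (hp : 1 < p)
    (d : Descent p u u' c z) {y : ℝ} (hzy : z ≤ y) (hu'y : u' y = 0) (hF : 0 < F p (u y)) :
    |u y| < u c := by
  have hn' : (3 : ℝ) ≤ n := by exact_mod_cast hn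
  have h1 : energy p u u' z < energy p u u' c := by
    refine gt_of_hasDerivAt_neg d.lt
      ((h.continuousOn_energy hp).mono fun x hx => d.nonneg.trans hx.1)
      (fun x hx => h.hasDerivAt_energy hp (d.nonneg.trans_lt hx.1)) fun x hx => ?_
    have e1 := (d.neg x ⟨hx.1, hx.2.le⟩).ne
    have e2 : 0 < x := d.nonneg.trans_lt hx.1
    have e3 : 0 < (n : ℝ) - 1 := by linarith
    exact neg_neg_of_pos (by positivity)
  have h2 := h.energy_antitone hn hp (d.nonneg.trans d.lt.le) hzy
  have h3 := d.energy_pos c ⟨le_rfl, d.lt.le⟩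
  have h4 := h2.trans_lt h1
  have h5 := d.pos c ⟨le_rfl, d.lt⟩
  rw [energy, hu'y, energy, d.crit] at h4
  rw [energy, d.crit] at h3
  by_contra! hcon
  have := F_mono (s := u c) (t := u y) hp (by linarith) (by rwa [abs_of_pos h5])
  linarith

theorem exists_goodDescent_next (h : RadialPair n p u u' v v') (hn : 3 ≤ n) (hp : 1 < p)
    (hp2 : p < ((n : ℝ) + 2) / ((n : ℝ) - 2)) {τ c₂ z₂ : ℝ} (g : GoodDescent p u u' v v' c z τ)
    (as : Ascent p (fun r => -u r) (fun r => -u' r) z c₂)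
    (d₂ : Descent p (fun r => -u r) (fun r => -u' r) c₂ z₂) :
    (∃ τ₂, GoodDescent p (fun r => -u r) (fun r => -u' r) (fun r => -v r) (fun r => -v' r)
      c₂ z₂ τ₂) ∧ ∀ r ∈ Icc z c₂, 0 < -v r := by
  have d := g.descent
  have huτ := d.pos τ (Ioo_subset_Ico_self g.mem)
  obtain ⟨θ, hθ⟩ : ∃ θ, θ = -(τ * u' τ) / u τ := ⟨_, rfl⟩
  have hθ0 : 0 ≤ θ := by
    have e1 := d.neg τ ⟨g.mem.1, g.mem.2.le⟩
    have e2 : 0 < τ := d.nonneg.trans_lt g.mem.1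
    rw [hθ]
    exact div_nonneg (by nlinarith) huτ.le
  have hcrit : criticalExponent p (u τ) ≤ θ := hθ ▸ g.crit
  obtain ⟨hv, hW⟩ := h.neg_after_zero hn hp hp2 d g.mem g.zero g.deriv_neg hθ
    (le_of_criticalExponent_le hp huτ.ne' hcrit)
  have hvz := hv z ⟨g.mem.2, le_rfl⟩
  have hz0 : 0 < z := d.nonneg.trans_lt d.lt
  have hU : 0 < wronskian n u u' v v' z := by
    have := mul_pos_of_neg_of_neg (d.neg z ⟨d.lt, le_rfl⟩) hvz
    rw [wronskian, d.zero, zero_mul, sub_zero]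
    positivity
  have hWβ : ∀ β ≤ θ, scalingWronskian n p β (fun r => -u r) (fun r => -u' r) (fun r => -v r)
      (fun r => -v' r) z ≤ 0 := by
    intro β hβ
    rw [scalingWronskian_neg, scalingWronskian_eq_add β θ]
    nlinarith
  obtain ⟨hpos, hUc⟩ := h.neg.pos_on_ascent hn hp as (neg_pos.2 hvz) (hWβ 0 hθ0)
  refine ⟨?_, hpos⟩
  obtain ⟨τ₂, hτ₂, hv₂, hv'₂, hvpos⟩ := h.neg.exists_first_zero hn hp d₂
    (hpos c₂ ⟨as.lt.le, le_rfl⟩) hUc.le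
  refine ⟨τ₂, d₂, hτ₂, hv₂, hv'₂, hvpos, ?_⟩
  have huτ₂ := d₂.pos τ₂ (Ioo_subset_Ico_self hτ₂)
  have huc₂ := d₂.pos c₂ ⟨le_rfl, d₂.lt⟩
  have hlt := h.neg.descent_lt d₂ le_rfl hτ₂.1 hτ₂.2.le
  have hθ₂ : 0 ≤ -(τ₂ * -u' τ₂) / -u τ₂ := by
    have e1 := d₂.neg τ₂ ⟨hτ₂.1, hτ₂.2.le⟩
    have e2 : 0 < τ₂ := d₂.nonneg.trans_lt hτ₂.1
    exact div_nonneg (by nlinarith) huτ₂.le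
  have hlev : criticalExponent p (-u τ₂) < criticalExponent p (-u c₂) :=
    criticalExponent_lt hp huτ₂.ne' (by rwa [abs_of_pos huτ₂, abs_of_pos huc₂])
  have hstep : ∀ β, 0 ≤ β → β ≤ θ → β ≤ criticalExponent p (-u τ₂) →
      β ≤ -(τ₂ * -u' τ₂) / -u τ₂ := by
    intro β h0 h1 h2
    have e1 := (h.neg.ascent_conclusion hn hp as (neg_pos.2 hvz) h0
      (lt_of_lt_criticalExponent hp huc₂.ne' (h2.trans_lt hlev)) (hWβ β h1)).2
    exact h.neg.le_ratio_of_scalingWronskian_nonpos hn hp d₂ hτ₂ hvpos hv₂ hv'₂ e1.le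
      (two_le_of_le_criticalExponent hp huτ₂.ne' h2)
  by_contra! hcon
  rcases le_or_gt (criticalExponent p (-u τ₂)) θ with hle | hgt
  · exact absurd (hstep _ (hθ₂.trans hcon.le) hle le_rfl) (not_le.2 hcon)
  · have e1 := hstep θ hθ0 le_rfl hgt.le
    have hF : 0 < F p (u c₂) := by
      have := as.energy_pos c₂ ⟨as.lt.le, le_rfl⟩
      rw [energy, as.crit, F_neg] at this
      linarith
    have hu'c₂ : u' c₂ = 0 := neg_eq_zero.1 as.crit
    have habs : |u τ₂| = -u τ₂ := by rw [← abs_neg, abs_of_pos huτ₂]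
    have habsc : |u c₂| = -u c₂ := by rw [← abs_neg, abs_of_pos huc₂]
    have hτt : u τ < |u τ₂| := by
      by_contra! hle
      have : criticalExponent p (-u τ₂) ≤ criticalExponent p (u τ) := by
        rw [criticalExponent_neg]
        rcases hle.eq_or_lt with e | e
        · rw [criticalExponent, criticalExponent, e, abs_of_pos huτ]
        · exact (criticalExponent_lt hp (neg_ne_zero.1 huτ₂.ne') (by rwa [abs_of_pos huτ])).le
      linarith
    have e2 := h.ratio_comparison hn hp hp2 d g.mem as.lt.le hτ₂.1 hu'c₂ hF (fun r hr => by
      have h1 := ascent_nonneg as hr.1 hr.2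
      rw [habsc, ← abs_neg, abs_of_nonneg h1]
      rcases hr.2.eq_or_lt with rfl | hlt
      · exact le_rfl
      · exact (h.neg.ascent_lt as hr.1 hlt le_rfl).le)
      (h.abs_lt_of_critical_points hn hp d as.lt.le hu'c₂ hF) (by rw [habs, habsc]; exact hlt) hτt
      (by rw [← hθ]; rwa [criticalExponent_neg] at hgt)
    rw [← hθ] at e2
    have e3 : -(τ₂ * -u' τ₂) / -u τ₂ = -(τ₂ * u' τ₂) / u τ₂ := by
      rw [mul_neg, neg_div_neg_eq, neg_div]
    linarith

theorem deriv_neg_of_right_end (h : RadialPair n p u u' v v') (hp : 1 < p) (hc : 0 ≤ c)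
    (hcz : c < z) (hE : 0 < energy p u u' z) (huz : u z = 0) (hu' : ∀ r ∈ Ioo c z, u' r < 0) :
    u' z < 0 := by
  have h1 : Tendsto u' (nhdsWithin z (Iio z)) (nhds (u' z)) :=
    (h.deriv_u' z (hc.trans_lt hcz)).continuousAt.continuousWithinAt
  refine lt_of_le_of_ne (le_of_tendsto h1 ?_) fun e => ?_
  · filter_upwards [Ioo_mem_nhdsLT hcz] with r hr using (hu' r hr).le
  · rw [energy, e, huz, F_eq hp] at hE
    norm_num at hE

theorem descent_of_initial (h : RadialPair n p u u' v v') (hp : 1 < p) (hn : 3 ≤ n)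
    (hu'0 : u' 0 = 0) (hz : 0 < z) (hu : ∀ r ∈ Ico 0 z, 0 < u r) (huz : u z = 0)
    (hE : ∀ r ∈ Icc 0 z, 0 < energy p u u' r) : Descent p u u' 0 z := by
  have hf0 : 0 < f p (u 0) := by
    have := hE 0 ⟨le_rfl, hz.le⟩
    rw [energy, hu'0] at this
    exact f_pos_of_F_pos hp (hu 0 ⟨le_rfl, hz⟩) (by linarith)
  have hnear : ∃ ε > 0, ∀ x ∈ Ioo 0 ε, 0 < f p (u x) := by
    have h1 : Tendsto (fun r => f p (u r)) (nhdsWithin 0 (Ioi 0)) (nhds (f p (u 0))) :=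
      (h.continuousOn_f hp 0 self_mem_Ici).mono_left (nhdsWithin_mono _ Ioi_subset_Ici_self)
    obtain ⟨ε, hε, hsub⟩ := mem_nhdsGT_iff_exists_Ioo_subset.1 (h1.eventually (lt_mem_nhds hf0))
    exact ⟨ε, hε, hsub⟩
  obtain ⟨ε, hε, hfε⟩ := hnear
  have hsmall : ∀ a ∈ Ioo 0 ε, u' a < 0 := by
    intro a ha
    have h1 : a ^ (n - 1) * u' a < (0 : ℝ) ^ (n - 1) * u' 0 := by
      refine gt_of_hasDerivAt_neg (g := fun x => x ^ (n - 1) * u' x) ha.1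
        ((continuous_pow (n - 1)).continuousOn.mul (h.cont_u'.mono fun x hx => hx.1))
        (fun x hx => (hasDerivAt_weight hn hx.1).mul (h.deriv_u' x hx.1)) fun x hx => ?_
      have e1 := hfε x ⟨hx.1, hx.2.trans ha.2⟩
      have e2 : 0 < x ^ (n - 1) := pow_pos hx.1 _
      have e3 := mul_pos e2 e1
      linarith
    rw [hu'0, mul_zero] at h1
    exact (pos_iff_neg_of_mul_neg h1).1 (pow_pos ha.1 _)
  have hneg : ∀ r ∈ Ioo 0 z, u' r < 0 := by
    intro r hr
    obtain ⟨a, ha0, ha⟩ := exists_between (lt_min hr.1 hε)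
    have har := ha.trans_le (min_le_left _ _)
    exact h.deriv_neg_after hp ha0 (fun x hx => hE x ⟨ha0.le.trans hx.1, hx.2.trans hr.2.le⟩)
      (fun x hx => hu x ⟨ha0.le.trans hx.1, hx.2.trans_lt hr.2⟩)
      (hsmall a ⟨ha0, ha.trans_le (min_le_right _ _)⟩).le r ⟨har, le_rfl⟩
  refine ⟨le_rfl, hz, hu, huz, hu'0, fun r hr => ?_, hE⟩
  rcases hr.2.eq_or_lt with rfl | hlt
  · exact h.deriv_neg_of_right_end hp le_rfl hz (hE _ ⟨hz.le, le_rfl⟩) huz hneg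
  · exact hneg r ⟨hr.1, hlt⟩

/-- On a nodal interval away from the origin, `u` rises to a critical point and then falls. -/
theorem exists_ascent_descent (h : RadialPair n p u u' v v') (hp : 1 < p)
    (ha : 0 < a) (haz : a < z) (hua : u a = 0) (huz : u z = 0) (hu : ∀ r ∈ Ioo a z, 0 < u r)
    (hE : ∀ r ∈ Icc a z, 0 < energy p u u' r) :
    ∃ c, Ascent p u u' a c ∧ Descent p u u' c z := by
  obtain ⟨c, hc, hu'c⟩ := exists_hasDerivAt_eq_zero haz
    (h.cont_u.mono fun x hx => ha.le.trans hx.1) (hua.trans huz.symm)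
    fun x hx => h.deriv_u x (ha.trans hx.1)
  have hneg : ∀ r ∈ Ioo c z, u' r < 0 := fun r hr =>
    h.deriv_neg_after hp (ha.trans hc.1)
      (fun x hx => hE x ⟨hc.1.le.trans hx.1, hx.2.trans hr.2.le⟩)
      (fun x hx => hu x ⟨hc.1.trans_le hx.1, hx.2.trans_lt hr.2⟩) hu'c.le r ⟨hr.1, le_rfl⟩
  have hpos : ∀ r ∈ Ioo a c, 0 < u' r := by
    intro r hr
    by_contra! hle
    have := h.deriv_neg_after hp (ha.trans hr.1)
      (fun x hx => hE x ⟨hr.1.le.trans hx.1, hx.2.trans hc.2.le⟩)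
      (fun x hx => hu x ⟨hr.1.trans_le hx.1, hx.2.trans_lt hc.2⟩) hle c ⟨hr.2, le_rfl⟩
    linarith
  refine ⟨c, ⟨ha, hc.1, hua, fun r hr => hu r ⟨hr.1, hr.2.trans_lt hc.2⟩, hu'c, fun r hr => ?_,
    fun r hr => hE r ⟨hr.1, hr.2.trans hc.2.le⟩⟩, (ha.trans hc.1).le, hc.2,
    fun r hr => hu r ⟨hc.1.trans_le hr.1, hr.2⟩, huz, hu'c, fun r hr => ?_,
    fun r hr => hE r ⟨hc.1.le.trans hr.1, hr.2⟩⟩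
  · rcases hr.1.eq_or_lt with rfl | hlt
    · have h1 : Tendsto u' (nhdsWithin a (Ioi a)) (nhds (u' a)) :=
        (h.deriv_u' a ha).continuousAt.continuousWithinAt
      refine lt_of_le_of_ne (ge_of_tendsto h1 ?_) fun e => ?_
      · filter_upwards [Ioo_mem_nhdsGT hc.1] with r hr using (hpos r hr).le
      · have := hE a ⟨le_rfl, haz.le⟩
        rw [energy, ← e, hua, F_eq hp] at this
        norm_num at this
    · exact hpos r ⟨hlt, hr.2⟩
  · rcases hr.2.eq_or_lt with rfl | hlt
    · exact h.deriv_neg_of_right_end hp (ha.trans hc.1).le hc.2 (hE _ ⟨haz.le, le_rfl⟩) huz hneg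
    · exact hneg r ⟨hr.1, hlt⟩

theorem neg_after_descending_zero (h : RadialPair n p u u' v v') {z₂ : ℝ} (hz : 0 < z)
    (huz : u z = 0) (hu'z : u' z < 0) (hne : ∀ r ∈ Ioo z z₂, u r ≠ 0) :
    ∀ r ∈ Ioo z z₂, u r < 0 := by
  intro r hr
  by_contra! hle
  have hlt := lt_of_le_of_ne hle (hne r hr).symm
  have hex : ∃ y ∈ Ioo z r, u y < 0 := by
    by_contra! hcon
    have h2 := (hasDerivAt_iff_tendsto_slope.1 (h.deriv_u z hz)).mono_left
      (nhdsWithin_mono z (fun y (hy : z < y) => hy.ne') : nhdsWithin z (Ioi z) ≤ _)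
    refine absurd (ge_of_tendsto h2 ?_) (not_le.2 hu'z)
    filter_upwards [Ioo_mem_nhdsGT hr.1] with y hy
    rw [slope_def_field, huz, sub_zero]
    exact div_nonneg (hcon y hy) (by linarith [hy.1])
  obtain ⟨y, hy, huy⟩ := hex
  obtain ⟨x, hx, hx0⟩ := intermediate_value_Ioo hy.2.le
    (h.cont_u.mono fun x hx => hz.le.trans (hy.1.le.trans hx.1)) (⟨huy, hlt⟩ : (0 : ℝ) ∈ Ioo _ _)
  exact hne x ⟨hy.1.trans hx.1, hx.2.trans hr.2⟩ hx0

end RadialPair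

theorem RadialPair.of_solution {n : ℕ} {p α : ℝ} {u u' u'' v v' v'' : ℝ → ℝ}
    (hu : IsSolution n p α u u' u'') (hv : IsVariation n p u v v' v'') :
    RadialPair n p u u' v v' where
  cont_u := fun r hr => (hu.hasDeriv1 r hr).continuousWithinAt
  cont_u' := fun r hr => (hu.hasDeriv2 r hr).continuousWithinAt
  cont_v := fun r hr => (hv.hasDeriv1 r hr).continuousWithinAt
  cont_v' := fun r hr => (hv.hasDeriv2 r hr).continuousWithinAt
  deriv_u := fun r hr => (hu.hasDeriv1 r hr.le).hasDerivAt (Ici_mem_nhds hr)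
  deriv_u' := fun r hr => ((hu.hasDeriv2 r hr.le).hasDerivAt (Ici_mem_nhds hr)).congr_deriv
    (by linarith [hu.ode r hr])
  deriv_v := fun r hr => (hv.hasDeriv1 r hr.le).hasDerivAt (Ici_mem_nhds hr)
  deriv_v' := fun r hr => ((hv.hasDeriv2 r hr.le).hasDerivAt (Ici_mem_nhds hr)).congr_deriv
    (by linarith [hv.ode r hr])

/-- On the nodal interval `(a, z)`, `v` is positive up to a critical point of `u`, after which
`u` falls to `0` and `v` has a good zero at `τ`. -/
def GoodNode (p : ℝ) (u u' v v' : ℝ → ℝ) (a z τ : ℝ) : Prop :=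
  ∃ c, 0 ≤ a ∧ a ≤ c ∧ (∀ r ∈ Icc a c, 0 < v r) ∧ GoodDescent p u u' v v' c z τ

namespace RadialPair

variable {n : ℕ} {p : ℝ} {u u' v v' : ℝ → ℝ} {a z τ : ℝ}

theorem goodNode_next (h : RadialPair n p u u' v v') (hn : 3 ≤ n) (hp : 1 < p)
    (hp2 : p < ((n : ℝ) + 2) / ((n : ℝ) - 2)) (h0 : u 0 ≠ 0)
    (g : GoodNode p u u' v v' a z τ) {z₂ : ℝ} (hz₂ : z < z₂) (huz₂ : u z₂ = 0)
    (hne : ∀ r ∈ Ioo z z₂, u r ≠ 0) :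
    ∃ τ₂, GoodNode p (fun r => -u r) (fun r => -u' r) (fun r => -v r) (fun r => -v' r)
      z z₂ τ₂ := by
  obtain ⟨c, ha, hac, -, g⟩ := g
  have hc : 0 ≤ c := ha.trans hac
  have hz : 0 < z := hc.trans_lt g.descent.lt
  have hneg := h.neg_after_descending_zero hz g.descent.zero
    (g.descent.neg z ⟨g.descent.lt, le_rfl⟩) hne
  obtain ⟨c₂, as, d₂⟩ := h.neg.exists_ascent_descent hp hz hz₂
    (by simp [g.descent.zero]) (by simp [huz₂]) (fun r hr => neg_pos.2 (hneg r hr))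
    (fun r hr => by
      rw [energy_neg]
      exact h.energy_pos hn hp h0 (hz.trans hz₂) huz₂ (hz.le.trans hr.1) hr.2)
  obtain ⟨⟨τ₂, g₂⟩, hpos⟩ := h.exists_goodDescent_next hn hp hp2 g as d₂
  exact ⟨τ₂, c₂, hz.le, as.lt.le, hpos, g₂⟩

theorem goodNode_initial (h : RadialPair n p u u' v v') (hn : 3 ≤ n) (hp : 1 < p)
    (h0 : 0 < u 0) (hu'0 : u' 0 = 0) (hv0 : 0 < v 0) (hz : 0 < z) (huz : u z = 0)
    (hne : ∀ r ∈ Ioo 0 z, u r ≠ 0) : ∃ τ, GoodNode p u u' v v' 0 z τ := by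
  have hpos : ∀ r ∈ Ico 0 z, 0 < u r := by
    intro r hr
    by_contra! hle
    obtain ⟨x, hx, hx0⟩ := intermediate_value_Icc' hr.1
      (h.cont_u.mono fun x hx => hx.1) (⟨hle, h0.le⟩ : (0 : ℝ) ∈ Icc _ _)
    rcases hx.1.eq_or_lt with rfl | hlt
    · exact h0.ne' hx0
    · exact hne x ⟨hlt, hx.2.trans_lt hr.2⟩ hx0
  obtain ⟨τ, g⟩ := h.exists_goodDescent_zero hn hp (h.descent_of_initial hp hn hu'0 hz hpos huz
    fun r hr => h.energy_pos hn hp h0.ne' hz huz hr.1 hr.2) hv0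
  refine ⟨τ, 0, le_rfl, le_rfl, fun r hr => ?_, g⟩
  rwa [le_antisymm hr.2 hr.1]

theorem goodNode_spec (h : RadialPair n p u u' v v') (hn : 3 ≤ n) (hp : 1 < p)
    (hp2 : p < ((n : ℝ) + 2) / ((n : ℝ) - 2)) (g : GoodNode p u u' v v' a z τ) :
    τ ∈ Ioo a z ∧ v τ = 0 ∧ 0 < u' τ * v' τ ∧ ∀ r ∈ Icc a z, v r = 0 → r = τ := by
  obtain ⟨c, ha, hac, hpos, g⟩ := g
  have d := g.descent
  refine ⟨⟨hac.trans_lt g.mem.1, g.mem.2⟩, g.zero,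
    mul_pos_of_neg_of_neg (d.neg τ ⟨g.mem.1, g.mem.2.le⟩) g.deriv_neg, fun r hr hvr => ?_⟩
  have huτ : u τ ≠ 0 := (d.pos τ ⟨g.mem.1.le, g.mem.2⟩).ne'
  have hneg := (h.neg_after_zero hn hp hp2 d g.mem g.zero g.deriv_neg rfl
    (le_of_criticalExponent_le hp huτ g.crit)).1
  rcases lt_trichotomy r τ with hlt | rfl | hlt
  · rcases le_total r c with hrc | hrc
    · exact absurd hvr (hpos r ⟨hr.1, hrc⟩).ne'
    · exact absurd hvr (g.pos r ⟨hrc, hlt⟩).ne'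
  · rfl
  · exact absurd hvr (hneg r ⟨hlt, hr.2⟩).ne

/-- Every nodal interval carries, up to a common sign, a good node. -/
theorem exists_goodNode (h : RadialPair n p u u' v v') (hn : 3 ≤ n) (hp : 1 < p)
    (hp2 : p < ((n : ℝ) + 2) / ((n : ℝ) - 2)) (h0 : 0 < u 0) (hu'0 : u' 0 = 0) (hv0 : 0 < v 0)
    {k : ℕ} {y : ℕ → ℝ} (hy0 : y 0 = 0) (hy : ∀ i < k, y i < y (i + 1))
    (huy : ∀ i < k, u (y (i + 1)) = 0) (hne : ∀ i < k, ∀ r ∈ Ioo (y i) (y (i + 1)), u r ≠ 0) :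
    ∀ i < k, ∃ τ, GoodNode p u u' v v' (y i) (y (i + 1)) τ ∨
      GoodNode p (fun r => -u r) (fun r => -u' r) (fun r => -v r) (fun r => -v' r)
        (y i) (y (i + 1)) τ := by
  intro i
  induction i with
  | zero =>
    intro hi
    have h1 := hy 0 hi
    have h2 := hne 0 hi
    rw [hy0] at h1 h2 ⊢
    obtain ⟨τ, g⟩ := h.goodNode_initial hn hp h0 hu'0 hv0 h1 (huy 0 hi) h2
    exact ⟨τ, Or.inl g⟩
  | succ i ih =>
    intro hi
    obtain ⟨τ, g | g⟩ := ih (by omega)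
    · obtain ⟨τ₂, g₂⟩ := h.goodNode_next hn hp hp2 h0.ne' g (hy _ hi) (huy _ hi) (hne _ hi)
      exact ⟨τ₂, Or.inr g₂⟩
    · obtain ⟨τ₂, g₂⟩ := h.neg.goodNode_next hn hp hp2 (neg_ne_zero.2 h0.ne') g (hy _ hi)
        (by simp [huy _ hi]) (fun r hr => neg_ne_zero.2 (hne _ hi r hr))
      simp only [neg_neg] at g₂
      exact ⟨τ₂, Or.inl g₂⟩

/-- The zeros of `v` interlace with the endpoints of the nodal intervals of `u`. -/
theorem exists_interlacing_zero (h : RadialPair n p u u' v v') (hn : 3 ≤ n) (hp : 1 < p)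
    (hp2 : p < ((n : ℝ) + 2) / ((n : ℝ) - 2)) (h0 : 0 < u 0) (hu'0 : u' 0 = 0) (hv0 : 0 < v 0)
    {k : ℕ} {y : ℕ → ℝ} (hy0 : y 0 = 0) (hy : ∀ i < k, y i < y (i + 1))
    (huy : ∀ i < k, u (y (i + 1)) = 0) (hne : ∀ i < k, ∀ r ∈ Ioo (y i) (y (i + 1)), u r ≠ 0)
    {i : ℕ} (hi : i < k) :
    ∃ τ ∈ Ioo (y i) (y (i + 1)), v τ = 0 ∧ 0 < u' τ * v' τ ∧
      ∀ r ∈ Icc (y i) (y (i + 1)), v r = 0 → r = τ := by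
  obtain ⟨τ, g | g⟩ := h.exists_goodNode hn hp hp2 h0 hu'0 hv0 hy0 hy huy hne i hi
  · exact ⟨τ, h.goodNode_spec hn hp hp2 g⟩
  · have := h.neg.goodNode_spec hn hp hp2 g
    simp only [neg_eq_zero, neg_mul_neg] at this
    exact ⟨τ, this⟩

end RadialPair

/-- on `[0, z_k]` the variation `v` has exactly `k` zeros `τ₁ < ⋯ < τ_k`,
interlaced with the zeros of `u`, and `u' v' > 0` at each of them. -/
theorem statement4 (n : ℕ) (hn : 3 ≤ n) (p : ℝ) (hp1 : 1 < p)
    (hp2 : p < ((n : ℝ) + 2) / ((n : ℝ) - 2))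
    (α : ℝ) (hα : 0 < α) (u u' u'' v v' v'' : ℝ → ℝ)
    (hu : IsSolution n p α u u' u'') (hv : IsVariation n p u v v' v'')
    (hsign : ChangesSign u)
    (k : ℕ) (hk : 0 < k) (z : Fin k → ℝ) (hz : ExactZeros u k z) :
    ∃ τ : Fin k → ℝ, StrictMono τ ∧
      (∀ i, 0 < τ i ∧ τ i ≤ z ⟨k - 1, by omega⟩ ∧ v (τ i) = 0) ∧
      (∀ r : ℝ, 0 ≤ r → r ≤ z ⟨k - 1, by omega⟩ → v r = 0 → ∃ i, r = τ i) ∧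
      (∀ i, τ i < z i) ∧
      (∀ i j : Fin k, (j : ℕ) + 1 = (i : ℕ) → z j < τ i) ∧
      (∀ i, 0 < u' (τ i) * v' (τ i)) := by
  have h := RadialPair.of_solution hu hv
  obtain ⟨hmono, hz0, hzall⟩ := hz
  set y : ℕ → ℝ := fun i => if hi : 0 < i ∧ i ≤ k then z ⟨i - 1, by omega⟩ else 0 with hydef
  have hy0 : y 0 = 0 := by simp [hydef]
  have hys : ∀ i : Fin k, y (i + 1) = z i := fun i => by simp [hydef]
  have hys' : ∀ i (hi : i < k), y (i + 1) = z ⟨i, hi⟩ := fun i hi => hys ⟨i, hi⟩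
  have hy : ∀ i < k, y i < y (i + 1) := by
    intro i hi
    rw [hys' i hi]
    cases i with
    | zero => rw [hy0]; exact (hz0 _).1
    | succ j => rw [hys' j (by omega)]; exact hmono (Fin.mk_lt_mk.2 j.lt_succ_self)
  have hne : ∀ i < k, ∀ r ∈ Ioo (y i) (y (i + 1)), u r ≠ 0 := by
    intro i hi r hr hur
    rw [hys' i hi] at hr
    have hr0 : 0 < r := by
      cases i with
      | zero => rw [hy0] at hr; exact hr.1
      | succ j => rw [hys' j (by omega)] at hr; exact (hz0 _).1.trans hr.1
    obtain ⟨j, rfl⟩ := hzall r hr0 hur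
    have h1 := Fin.lt_def.1 (hmono.lt_iff_lt.1 hr.2)
    cases i with
    | zero => simp at h1
    | succ i =>
      rw [hys' i (by omega)] at hr
      have h2 := Fin.lt_def.1 (hmono.lt_iff_lt.1 hr.1)
      simp only at h1 h2
      omega
  have key : ∀ i : Fin k, ∃ τ ∈ Ioo (y i) (y (i + 1)), v τ = 0 ∧ 0 < u' τ * v' τ ∧
      ∀ r ∈ Icc (y i) (y (i + 1)), v r = 0 → r = τ := fun i =>
    h.exists_interlacing_zero hn hp1 hp2 (by rwa [hu.init]) hu.initDeriv
      (by rw [hv.init]; exact one_pos) hy0 hy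
      (fun i hi => by rw [hys' i hi]; exact (hz0 _).2) hne i.2
  choose τ hτ hvτ hd huniq using key
  have hlt : ∀ i, τ i < z i := fun i => (hys i).symm ▸ (hτ i).2
  have hgt : ∀ i j : Fin k, (j : ℕ) + 1 = (i : ℕ) → z j < τ i := by
    intro i j hij
    have := (hτ i).1
    rwa [← hij, hys] at this
  have hgt' : ∀ i j : Fin k, j < i → z j < τ i := by
    intro i j hij
    have hij' := Fin.lt_def.1 hij
    refine (hmono.monotone ?_).trans_lt (hgt i ⟨i - 1, by omega⟩ (by simp; omega))
    exact Fin.le_def.2 (by simp; omega)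
  refine ⟨τ, fun i j hij => (hlt i).trans (hgt' j i hij), fun i => ⟨?_, ?_, hvτ i⟩, ?_, hlt, hgt,
    hd⟩
  · obtain ⟨i, hi⟩ := i
    cases i with
    | zero => have := (hτ ⟨0, hi⟩).1; rwa [hy0] at this
    | succ j => exact (hz0 ⟨j, by omega⟩).1.trans (hgt _ _ rfl)
  · exact (hlt i).le.trans (hmono.monotone (Fin.le_def.2 (by simp; omega)))
  · intro r hr hrk hvr
    have hex : ∃ i, r ≤ y (i + 1) := ⟨k - 1, by rwa [hys' (k - 1) (by omega)]⟩
    classical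
    have hle := Nat.find_spec hex
    have hik : Nat.find hex < k :=
      (Nat.find_min' hex (by rwa [hys' (k - 1) (by omega)])).trans_lt (by omega)
    refine ⟨⟨Nat.find hex, hik⟩, huniq _ r ⟨?_, hle⟩ hvr⟩
    rcases Nat.eq_zero_or_pos (Nat.find hex) with h1 | h1
    · simp only [h1, hy0, hr]
    · have h2 := Nat.find_min hex (Nat.sub_one_lt h1.ne')
      rw [Nat.sub_add_cancel h1, not_le] at h2
      exact h2.le
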